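/- For every integer k ≥ 1 there is a constant c (depending only on k) such that for every finite simple graph G of rank width at most k on n vertices and every finite simple graph H not isomorphic to G, the (6k+3)-dimensional Weisfeiler–Leman algorithm run for at most c·(log₂ n + 1) rounds distinguishes G from H. In particular, (6k+3)-WL identifies graphs of rank width at most k in O(log n) rounds. -/

import Mathlib

/-!
Statement 0: the (6k+3)-dimensional Weisfeiler--Leman algorithm identifies graphs of
rank width ≤ k in O(log n) rounds.
-/

/-- The type of color values computed by the `k`-dimensional Weisfeiler--Leman algorithm
after `r` refinement steps (index `0` is the initial/atomic coloring, so index `r`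
corresponds to `r + 1` rounds in the convention where the initial coloring is round one). -/
def WLColorType (k : ℕ) (C : Type) : ℕ → Type
  | 0 => (Fin k → Fin k → Prop) × (Fin k → Fin k → Prop) × (Fin k → C)
  | (r + 1) => WLColorType k C r × Multiset (Fin k → WLColorType k C r)

/-- The `k`-WL coloring of `k`-tuples of vertices of a vertex-colored graph `(G, χ)`:
`wlColor G χ k 0 v̄` is the atomic type of `v̄` (the equality pattern, the adjacency
pattern, and the vertex colors), and
`wlColor G χ k (r+1) v̄ = (wlColor G χ k r v̄, {{(colors of v̄ with i-th entry replaced by x)ᵢ : x ∈ V}})`. -/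
def wlColor {V C : Type} [Fintype V] [DecidableEq V] (G : SimpleGraph V) (χ : V → C) (k : ℕ) :
    (r : ℕ) → (Fin k → V) → WLColorType k C r
  | 0 => fun vb => (fun i j => vb i = vb j, fun i j => G.Adj (vb i) (vb j), fun i => χ (vb i))
  | (r + 1) => fun vb =>
      (wlColor G χ k r vb,
        (Finset.univ : Finset V).val.map fun x i => wlColor G χ k r (Function.update vb i x))

/-- The multiset `{{χ_{k,r}(v̄) : v̄ ∈ V^k}}` of `k`-WL colors of all `k`-tuples:
two graphs are distinguished by `(k, r+1)`-round WL iff these multisets differ. -/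
def wlMultiset {V C : Type} [Fintype V] [DecidableEq V] (G : SimpleGraph V) (χ : V → C)
    (k r : ℕ) : Multiset (WLColorType k C r) :=
  (Finset.univ : Finset (Fin k → V)).val.map (wlColor G χ k r)

open Classical in
/-- `ρ_G(X)`: the `F₂`-rank of the `X × X̄` cut matrix `M(X, X̄)` whose `(u, w)` entry is `1`
iff `uw ∈ E(G)`. -/
noncomputable def cutRank {V : Type} [Fintype V] [DecidableEq V] (G : SimpleGraph V)
    (X : Finset V) : ℕ :=
  (Matrix.of fun (u : ↥X) (w : ↥(Xᶜ)) => if G.Adj ↑u ↑w then (1 : ZMod 2) else 0).rank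

/-- Binary rooted trees with leaves labelled by vertices.  Such a tree `T` (with each vertex
occurring at exactly one leaf) determines a rank decomposition `(T, γ)`, where `γ(t)` is the
set of leaf labels below `t`. -/
inductive RWTree (V : Type) : Type
  | leaf : V → RWTree V
  | node : RWTree V → RWTree V → RWTree V

namespace RWTree

/-- The multiset of leaf labels of a tree, i.e. `γ(t)` (with multiplicities). -/
def leaves {V : Type} : RWTree V → Multiset V
  | leaf v => {v}
  | node l r => leaves l + leaves r

/-- The list of all subtrees (one for each node) of a tree. -/
def subtrees {V : Type} : RWTree V → List (RWTree V)
  | leaf v => [leaf v]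
  | node l r => node l r :: (subtrees l ++ subtrees r)

end RWTree

/-- `G` has rank width at most `k`: there is a rank decomposition, given by a binary rooted
tree whose leaves are labelled bijectively by the vertices of `G`, all of whose nodes `t`
satisfy `ρ_G(γ(t)) ≤ k`. -/
def RankwidthLE {V : Type} [Fintype V] [DecidableEq V] (G : SimpleGraph V) (k : ℕ) : Prop :=
  ∃ t : RWTree V, t.leaves = (Finset.univ : Finset V).val ∧
    ∀ s ∈ t.subtrees, cutRank G s.leaves.toFinset ≤ k


set_option linter.unusedSectionVars false

open Classical in
theorem exists_equiv_of_map_univ_eq {V W T : Type} [Fintype V] [Fintype W] (f : V → T) (g : W → T)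
    (h : (Finset.univ : Finset V).val.map f = (Finset.univ : Finset W).val.map g) :
    ∃ e : V ≃ W, ∀ x, f x = g (e x) := by
  have hc : ∀ t : T, Nonempty ({x // f x = t} ≃ {x // g x = t}) := by
    intro t
    have := congrArg (Multiset.count t) h
    rw [Multiset.count_map, Multiset.count_map] at this
    refine ⟨Fintype.equivOfCardEq ?_⟩
    rw [Fintype.card_subtype, Fintype.card_subtype]
    simp only [eq_comm (a := t)] at this
    exact this
  refine ⟨Equiv.ofFiberEquiv (fun t => (hc t).some), fun x => ?_⟩
  exact (Equiv.ofFiberEquiv_map _ x).symm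

theorem wlColor_succ_iff {V W C : Type} [Fintype V] [DecidableEq V] [Fintype W] [DecidableEq W]
    (G : SimpleGraph V) (H : SimpleGraph W) (χ : V → C) (χ' : W → C) (m r : ℕ)
    (u : Fin m → V) (u' : Fin m → W) :
    wlColor G χ m (r + 1) u = wlColor H χ' m (r + 1) u' ↔
      wlColor G χ m r u = wlColor H χ' m r u' ∧
      ∃ f : V ≃ W, ∀ x i, wlColor G χ m r (Function.update u i x) =
        wlColor H χ' m r (Function.update u' i (f x)) := by
  constructor
  · intro h
    have h' := Prod.ext_iff.1 h
    refine ⟨h'.1, ?_⟩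
    obtain ⟨e, he⟩ := exists_equiv_of_map_univ_eq _ _ h'.2
    exact ⟨e, fun x i => congrFun (he x) i⟩
  · rintro ⟨h1, f, hf⟩
    refine Prod.ext_iff.2 ⟨h1, ?_⟩
    show (Finset.univ : Finset V).val.map _ = (Finset.univ : Finset W).val.map _
    have : (Finset.univ : Finset W) = (Finset.univ : Finset V).map f.toEmbedding := by simp
    rw [this, Finset.map_val, Multiset.map_map]
    refine Multiset.map_congr rfl ?_
    intro x _
    funext i
    exact hf x i

theorem wlColor_mono {V W C : Type} [Fintype V] [DecidableEq V] [Fintype W] [DecidableEq W]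
    (G : SimpleGraph V) (H : SimpleGraph W) (χ : V → C) (χ' : W → C) (m r d : ℕ)
    (u : Fin m → V) (u' : Fin m → W)
    (h : wlColor G χ m (r + d) u = wlColor H χ' m (r + d) u') :
    wlColor G χ m r u = wlColor H χ' m r u' := by
  induction d with
  | zero => exact h
  | succ d ih => exact ih ((wlColor_succ_iff G H χ χ' m (r + d) u u').1 h).1

theorem wlColor_perm {V W C : Type} [Fintype V] [DecidableEq V] [Fintype W] [DecidableEq W]
    (G : SimpleGraph V) (H : SimpleGraph W) (χ : V → C) (χ' : W → C) (m r : ℕ)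
    (π : Fin m ≃ Fin m) (u : Fin m → V) (u' : Fin m → W)
    (h : wlColor G χ m r u = wlColor H χ' m r u') :
    wlColor G χ m r (u ∘ π) = wlColor H χ' m r (u' ∘ π) := by
  induction r generalizing u u' with
  | zero =>
    have h' := Prod.ext_iff.1 h
    have h'' := Prod.ext_iff.1 h'.2
    refine Prod.ext_iff.2 ⟨?_, Prod.ext_iff.2 ⟨?_, ?_⟩⟩
    · funext i j; exact congrFun (congrFun h'.1 (π i)) (π j)
    · funext i j; exact congrFun (congrFun h''.1 (π i)) (π j)
    · funext i; exact congrFun h''.2 (π i)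
  | succ r ih =>
    rw [wlColor_succ_iff] at h ⊢
    obtain ⟨h1, f, hf⟩ := h
    refine ⟨ih _ _ h1, f, fun x i => ?_⟩
    have e1 : Function.update (u ∘ π) i x = (Function.update u (π i) x) ∘ π := by
      funext j; simp [Function.update_apply]
    have e2 : Function.update (u' ∘ π) i (f x) = (Function.update u' (π i) (f x)) ∘ π := by
      funext j; simp [Function.update_apply]
    rw [e1, e2]
    exact ih _ _ (hf x (π i))

/-- tuples: `N` pebbles and three auxiliary entries -/
def tup3 {V : Type} {N : ℕ} (p : Fin N → V) (x y z : V) : Fin (N + 3) → V :=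
  Fin.append p ![x, y, z]

section C3
variable {V W : Type} [Fintype V] [DecidableEq V] [Fintype W] [DecidableEq W] {N : ℕ}
  (G : SimpleGraph V) (H : SimpleGraph W)

def C3 (r : ℕ) (p : Fin N → V) (x y z : V) : WLColorType (N + 3) Unit r :=
  wlColor G (fun _ => ()) (N + 3) r (tup3 p x y z)

theorem tup3_swap12 (p : Fin N → V) (x y z : V) :
    tup3 p y x z = tup3 p x y z ∘ (Equiv.swap (Fin.natAdd N 0) (Fin.natAdd N 1)) := by
  funext i
  refine Fin.addCases (fun i => ?_) (fun i => ?_) i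
  · have h1 : Fin.castAdd 3 i ≠ Fin.natAdd N 0 := by
      intro h; have := congrArg Fin.val h; simp at this; omega
    have h2 : Fin.castAdd 3 i ≠ Fin.natAdd N 1 := by
      intro h; have := congrArg Fin.val h; simp at this; omega
    simp [tup3, Equiv.swap_apply_of_ne_of_ne h1 h2]
  · fin_cases i
    · simp only [tup3, Function.comp]
      erw [Equiv.swap_apply_left]
      simp
    · simp only [tup3, Function.comp]
      erw [Equiv.swap_apply_right]
      simp
    · have h1 : Fin.natAdd N (2 : Fin 3) ≠ Fin.natAdd N 0 := by
        intro h; have := congrArg Fin.val h; simp at this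
      have h2 : Fin.natAdd N (2 : Fin 3) ≠ Fin.natAdd N 1 := by
        intro h; have := congrArg Fin.val h; simp at this
      simp only [tup3, Function.comp]
      erw [Equiv.swap_apply_of_ne_of_ne h1 h2]
      simp

theorem tup3_swap23 (p : Fin N → V) (x y z : V) :
    tup3 p x z y = tup3 p x y z ∘ (Equiv.swap (Fin.natAdd N 1) (Fin.natAdd N 2)) := by
  funext i
  refine Fin.addCases (fun i => ?_) (fun i => ?_) i
  · have h1 : Fin.castAdd 3 i ≠ Fin.natAdd N 1 := by
      intro h; have := congrArg Fin.val h; simp at this; omega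
    have h2 : Fin.castAdd 3 i ≠ Fin.natAdd N 2 := by
      intro h; have := congrArg Fin.val h; simp at this; omega
    simp [tup3, Equiv.swap_apply_of_ne_of_ne h1 h2]
  · fin_cases i
    · have h1 : Fin.natAdd N (0 : Fin 3) ≠ Fin.natAdd N 1 := by
        intro h; have := congrArg Fin.val h; simp at this
      have h2 : Fin.natAdd N (0 : Fin 3) ≠ Fin.natAdd N 2 := by
        intro h; have := congrArg Fin.val h; simp at this
      simp only [tup3, Function.comp]
      erw [Equiv.swap_apply_of_ne_of_ne h1 h2]
      simp
    · simp only [tup3, Function.comp]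
      erw [Equiv.swap_apply_left]
      simp
    · simp only [tup3, Function.comp]
      erw [Equiv.swap_apply_right]
      simp

variable {G H}

theorem C3_swap12 {r : ℕ} {p : Fin N → V} {p' : Fin N → W} {x y z : V} {x' y' z' : W}
    (h : C3 G r p x y z = C3 H r p' x' y' z') : C3 G r p y x z = C3 H r p' y' x' z' := by
  unfold C3 at h ⊢
  rw [tup3_swap12 p x y z, tup3_swap12 p' x' y' z']
  exact wlColor_perm _ _ _ _ _ _ _ _ _ h

theorem C3_swap23 {r : ℕ} {p : Fin N → V} {p' : Fin N → W} {x y z : V} {x' y' z' : W}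
    (h : C3 G r p x y z = C3 H r p' x' y' z') : C3 G r p x z y = C3 H r p' x' z' y' := by
  unfold C3 at h ⊢
  rw [tup3_swap23 p x y z, tup3_swap23 p' x' y' z']
  exact wlColor_perm _ _ _ _ _ _ _ _ _ h

theorem C3_mono {r s : ℕ} (hrs : r ≤ s) {p : Fin N → V} {p' : Fin N → W} {x y z : V} {x' y' z' : W}
    (h : C3 G s p x y z = C3 H s p' x' y' z') : C3 G r p x y z = C3 H r p' x' y' z' := by
  obtain ⟨d, rfl⟩ := Nat.exists_eq_add_of_le hrs
  exact wlColor_mono _ _ _ _ _ _ _ _ _ h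

theorem tup3_update3 (p : Fin N → V) (x y z w : V) :
    Function.update (tup3 p x y z) (Fin.natAdd N 2) w = tup3 p x y w := by
  funext i
  refine Fin.addCases (fun i => ?_) (fun i => ?_) i
  · have h2 : Fin.castAdd 3 i ≠ Fin.natAdd N 2 := by
      intro h; have := congrArg Fin.val h; simp at this; omega
    rw [Function.update_of_ne h2]
    simp [tup3]
  · by_cases hi : i = 2
    · subst hi; simp [tup3]
    · have h2 : Fin.natAdd N i ≠ Fin.natAdd N 2 := by simpa using hi
      rw [Function.update_of_ne h2]
      fin_cases i <;> simp_all [tup3]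

theorem tup3_updatep (p : Fin N → V) (x y z w : V) (j : Fin N) :
    Function.update (tup3 p x y z) (Fin.castAdd 3 j) w = tup3 (Function.update p j w) x y z := by
  funext i
  refine Fin.addCases (fun i => ?_) (fun i => ?_) i
  · by_cases hi : i = j
    · subst hi; simp [tup3]
    · have h2 : Fin.castAdd 3 i ≠ Fin.castAdd 3 j := by simpa using hi
      rw [Function.update_of_ne h2]
      simp [tup3, hi]
  · have h2 : Fin.natAdd N i ≠ Fin.castAdd 3 j := by
      intro h; have := congrArg Fin.val h; simp at this; omega
    rw [Function.update_of_ne h2]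
    simp [tup3]

theorem C3_step {r : ℕ} {p : Fin N → V} {p' : Fin N → W} {x y z : V} {x' y' z' : W}
    (h : C3 G (r + 1) p x y z = C3 H (r + 1) p' x' y' z') :
    ∃ f : V ≃ W, (∀ w, C3 G r p x y w = C3 H r p' x' y' (f w)) ∧
      ∀ w i, C3 G r (Function.update p i w) x y z =
        C3 H r (Function.update p' i (f w)) x' y' z' := by
  obtain ⟨_, f, hf⟩ := (wlColor_succ_iff G H _ _ _ r _ _).1 h
  refine ⟨f, fun w => ?_, fun w i => ?_⟩
  · have := hf w (Fin.natAdd N 2)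
    rwa [tup3_update3, tup3_update3] at this
  · have := hf w (Fin.castAdd 3 i)
    rwa [tup3_updatep, tup3_updatep] at this

theorem C3_atom {r : ℕ} {p : Fin N → V} {p' : Fin N → W} {x y z : V} {x' y' z' : W}
    (h : C3 G r p x y z = C3 H r p' x' y' z') (i j : Fin (N + 3)) :
    (tup3 p x y z i = tup3 p x y z j ↔ tup3 p' x' y' z' i = tup3 p' x' y' z' j) ∧
    (G.Adj (tup3 p x y z i) (tup3 p x y z j) ↔
      H.Adj (tup3 p' x' y' z' i) (tup3 p' x' y' z' j)) := by
  have h0 := C3_mono (Nat.zero_le r) h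
  have h' := Prod.ext_iff.1 h0
  have h'' := Prod.ext_iff.1 h'.2
  exact ⟨iff_of_eq (congrFun (congrFun h'.1 i) j), iff_of_eq (congrFun (congrFun h''.1 i) j)⟩

theorem C3_eq23 {r : ℕ} {p : Fin N → V} {p' : Fin N → W} {x y z : V} {x' y' z' : W}
    (h : C3 G r p x y z = C3 H r p' x' y' z') : y = z ↔ y' = z' := by
  have := (C3_atom h (Fin.natAdd N 1) (Fin.natAdd N 2)).1
  simpa [tup3] using this

theorem C3_eq12 {r : ℕ} {p : Fin N → V} {p' : Fin N → W} {x y z : V} {x' y' z' : W}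
    (h : C3 G r p x y z = C3 H r p' x' y' z') : x = y ↔ x' = y' :=
  C3_eq23 (C3_swap23 (C3_swap12 (C3_swap23 (C3_swap12 h))))

theorem C3_adj12 {r : ℕ} {p : Fin N → V} {p' : Fin N → W} {x y z : V} {x' y' z' : W}
    (h : C3 G r p x y z = C3 H r p' x' y' z') : G.Adj x y ↔ H.Adj x' y' := by
  have := (C3_atom h (Fin.natAdd N 0) (Fin.natAdd N 1)).2
  simpa [tup3] using this

theorem C3_eqp {r : ℕ} {p : Fin N → V} {p' : Fin N → W} {x y z : V} {x' y' z' : W}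
    (h : C3 G r p x y z = C3 H r p' x' y' z') (i : Fin N) : x = p i ↔ x' = p' i := by
  have := (C3_atom h (Fin.natAdd N 0) (Fin.castAdd 3 i)).1
  simpa [tup3] using this

theorem C3_adjp {r : ℕ} {p : Fin N → V} {p' : Fin N → W} {x y z : V} {x' y' z' : W}
    (h : C3 G r p x y z = C3 H r p' x' y' z') (i : Fin N) : G.Adj x (p i) ↔ H.Adj x' (p' i) := by
  have := (C3_atom h (Fin.natAdd N 0) (Fin.castAdd 3 i)).2
  simpa [tup3] using this

/-- copy the third entry over the second -/
theorem C3_copy {r : ℕ} {p : Fin N → V} {p' : Fin N → W} {x y z : V} {x' y' z' : W}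
    (h : C3 G (r + 1) p x y z = C3 H (r + 1) p' x' y' z') :
    C3 G r p x z z = C3 H r p' x' z' z' := by
  obtain ⟨f, hf, _⟩ := C3_step (C3_swap23 h)
  have h1 := hf z
  have h2 : f z = z' := ((C3_eq23 h1).1 rfl).symm
  rwa [h2] at h1

theorem C3_diag {r : ℕ} {p : Fin N → V} {p' : Fin N → W} {x y z : V} {x' y' z' : W}
    (h : C3 G (r + 2) p x y z = C3 H (r + 2) p' x' y' z') :
    C3 G r p z z z = C3 H r p' z' z' z' := by
  exact C3_copy (C3_swap12 (C3_copy h))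

/-- moving the pebbles in `S` -/
theorem C3_repebble {x y z : V} {x' y' z' : W} (S : Finset (Fin N)) (q : Fin N → V) :
    ∀ {r : ℕ} {p : Fin N → V} {p' : Fin N → W}, (∀ i, i ∉ S → q i = p i) →
    C3 G (r + S.card) p x y z = C3 H (r + S.card) p' x' y' z' →
    ∃ q' : Fin N → W, (∀ i, i ∉ S → q' i = p' i) ∧ C3 G r q x y z = C3 H r q' x' y' z' := by
  induction S using Finset.induction_on with
  | empty =>
    intro r p p' hq h
    have : q = p := funext fun i => hq i (by simp)
    subst this
    exact ⟨p', fun _ _ => rfl, h⟩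
  | insert a S ha ih =>
    intro r p p' hq h
    rw [Finset.card_insert_of_notMem ha, ← add_assoc] at h
    obtain ⟨f, _, hf⟩ := C3_step h
    obtain ⟨q', h1, h2⟩ := ih (p := Function.update p a (q a))
      (p' := Function.update p' a (f (q a))) (by
        intro i hi
        by_cases hia : i = a
        · subst hia; simp
        · rw [Function.update_of_ne hia]; exact hq i (by simp [hia, hi])) (hf (q a) a)
    refine ⟨q', fun i hi => ?_, h2⟩
    simp only [Finset.mem_insert, not_or] at hi
    rw [h1 i hi.2, Function.update_of_ne hi.1]
end C3

/-- reachability in at most `2^s` steps -/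
def rch {V : Type} (R : V → V → Prop) : ℕ → V → V → Prop
  | 0 => fun x y => x = y ∨ R x y
  | (s + 1) => fun x y => ∃ z, rch R s x z ∧ rch R s z y

theorem rch_imp {V : Type} (R : V → V → Prop) (s : ℕ) : ∀ x y, rch R s x y →
    Relation.ReflTransGen R x y := by
  induction s with
  | zero =>
    rintro x y (rfl | h)
    · exact .refl
    · exact .single h
  | succ s ih =>
    rintro x y ⟨z, h1, h2⟩
    exact (ih _ _ h1).trans (ih _ _ h2)

/-- reachability in at most `j` steps -/
def stp {V : Type} (R : V → V → Prop) : ℕ → V → V → Prop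
  | 0 => fun x y => x = y
  | (j + 1) => fun x y => stp R j x y ∨ ∃ z, stp R j x z ∧ R z y

theorem stp_add {V : Type} (R : V → V → Prop) (i j : ℕ) : ∀ x y, stp R (i + j) x y →
    ∃ z, stp R i x z ∧ stp R j z y := by
  induction j with
  | zero => intro x y h; exact ⟨y, h, rfl⟩
  | succ j ih =>
    rintro x y (h | ⟨w, h, hw⟩)
    · obtain ⟨z, h1, h2⟩ := ih x y h
      exact ⟨z, h1, Or.inl h2⟩
    · obtain ⟨z, h1, h2⟩ := ih x w h
      exact ⟨z, h1, Or.inr ⟨w, h2, hw⟩⟩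

theorem stp_rch {V : Type} (R : V → V → Prop) (s : ℕ) : ∀ x y, stp R (2 ^ s) x y → rch R s x y := by
  induction s with
  | zero =>
    rintro x y (h | ⟨z, h, hz⟩)
    · exact Or.inl h
    · have : x = z := h
      subst this
      exact Or.inr hz
  | succ s ih =>
    intro x y h
    rw [pow_succ, mul_two] at h
    obtain ⟨z, h1, h2⟩ := stp_add R _ _ x y h
    exact ⟨z, ih _ _ h1, ih _ _ h2⟩

theorem stp_le {V : Type} (R : V → V → Prop) {i j : ℕ} (hij : i ≤ j) {x y : V} (h : stp R i x y) :
    stp R j x y := by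
  induction j, hij using Nat.le_induction with
  | base => exact h
  | succ j _ ih => exact Or.inl ih

open Classical in
theorem reach_stp {V : Type} [Fintype V] (R : V → V → Prop) (n : ℕ) (hn : Fintype.card V ≤ n)
    (x y : V) (h : Relation.ReflTransGen R x y) : stp R n x y := by
  let B : ℕ → Finset V := fun j => Finset.univ.filter (stp R j x)
  have hB : ∀ j y, y ∈ B j ↔ stp R j x y := fun j y => by simp [B]
  -- either stable before or growing
  have key : ∀ j, j + 1 ≤ (B j).card ∨ ∃ i ≤ j, ∀ y, stp R (i + 1) x y → stp R i x y := by
    intro j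
    induction j with
    | zero =>
      left
      have : x ∈ B 0 := (hB 0 x).2 rfl
      exact Finset.card_pos.2 ⟨x, this⟩
    | succ j ih =>
      rcases ih with ih | ⟨i, hi, h⟩
      · by_cases hs : ∀ y, stp R (j + 1) x y → stp R j x y
        · exact Or.inr ⟨j, by omega, hs⟩
        · left
          push Not at hs
          obtain ⟨y, hy1, hy2⟩ := hs
          have : B j ⊂ B (j + 1) := by
            refine Finset.ssubset_iff_subset_ne.2 ⟨fun z hz => ?_, fun he => ?_⟩
            · exact (hB _ _).2 (Or.inl ((hB _ _).1 hz))
            · exact hy2 ((hB _ _).1 (he ▸ (hB _ _).2 hy1))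
          have := Finset.card_lt_card this
          omega
      · exact Or.inr ⟨i, by omega, h⟩
  obtain ⟨i, hi, hs⟩ : ∃ i ≤ n, ∀ y, stp R (i + 1) x y → stp R i x y := by
    rcases key n with h | h
    · have := Finset.card_le_univ (B n)
      omega
    · exact h
  refine stp_le R hi ?_
  induction h with
  | refl => exact stp_le R (Nat.zero_le i) rfl
  | tail _ hbc ih => exact hs _ (Or.inr ⟨_, ih, hbc⟩)

theorem rch_iff {V : Type} [Fintype V] (R : V → V → Prop) (s : ℕ) (hn : Fintype.card V ≤ 2 ^ s)
    (x y : V) : rch R s x y ↔ Relation.ReflTransGen R x y :=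
  ⟨rch_imp R s x y, fun h => stp_rch R s x y (reach_stp R _ hn x y h)⟩

/-- strong connectivity -/
def scc {V : Type} (R : V → V → Prop) (x y : V) : Prop :=
  Relation.ReflTransGen R x y ∧ Relation.ReflTransGen R y x

theorem scc_refl {V : Type} (R : V → V → Prop) (x : V) : scc R x x := ⟨.refl, .refl⟩
theorem scc_symm {V : Type} {R : V → V → Prop} {x y : V} (h : scc R x y) : scc R y x := ⟨h.2, h.1⟩
theorem scc_trans {V : Type} {R : V → V → Prop} {x y z : V} (h : scc R x y) (h' : scc R y z) :
    scc R x z := ⟨h.1.trans h'.1, h'.2.trans h.2⟩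

section CInv
variable {V W : Type} [Fintype V] [DecidableEq V] [Fintype W] [DecidableEq W] {N : ℕ}
  (G : SimpleGraph V) (H : SimpleGraph W)

def CInv (r : ℕ) (p : Fin N → V) (p' : Fin N → W) (R : V → V → Prop) (R' : W → W → Prop) : Prop :=
  ∀ x y z x' y' z', C3 G r p x y z = C3 H r p' x' y' z' → (R x y ↔ R' x' y')

variable {G H} {p : Fin N → V} {p' : Fin N → W} {R : V → V → Prop} {R' : W → W → Prop}

theorem CInv.mono {r s : ℕ} (h : CInv G H r p p' R R') (hrs : r ≤ s) : CInv G H s p p' R R' :=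
  fun _ _ _ _ _ _ hc => h _ _ _ _ _ _ (C3_mono hrs hc)

theorem CInv.symm {r : ℕ} (h : CInv G H r p p' R R') :
    CInv G H r p p' (fun x y => R y x) (fun x y => R' y x) :=
  fun _ _ _ _ _ _ hc => h _ _ _ _ _ _ (C3_swap12 hc)

theorem CInv.rch {r : ℕ} (h : CInv G H r p p' R R') (s : ℕ) :
    CInv G H (r + s) p p' (rch R s) (rch R' s) := by
  induction s with
  | zero =>
    intro x y z x' y' z' hc
    exact or_congr (C3_eq12 hc) (h _ _ _ _ _ _ hc)
  | succ s ih =>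
    intro x y z x' y' z' hc
    obtain ⟨f, hf, _⟩ := C3_step (r := r + s) hc
    constructor
    · rintro ⟨w, h1, h2⟩
      have := hf w
      exact ⟨f w, (ih _ _ _ _ _ _ (C3_swap23 this)).1 h1,
        (ih _ _ _ _ _ _ (C3_swap12 (C3_swap23 (C3_swap12 this)))).1 h2⟩
    · rintro ⟨w', h1, h2⟩
      have := hf (f.symm w')
      rw [f.apply_symm_apply] at this
      exact ⟨f.symm w', (ih _ _ _ _ _ _ (C3_swap23 this)).2 h1,
        (ih _ _ _ _ _ _ (C3_swap12 (C3_swap23 (C3_swap12 this)))).2 h2⟩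

theorem CInv.reach {r : ℕ} (h : CInv G H r p p' R R') (s : ℕ) (hV : Fintype.card V ≤ 2 ^ s)
    (hW : Fintype.card W ≤ 2 ^ s) :
    CInv G H (r + s) p p' (Relation.ReflTransGen R) (Relation.ReflTransGen R') := by
  intro x y z x' y' z' hc
  rw [← rch_iff R s hV, ← rch_iff R' s hW]
  exact h.rch s _ _ _ _ _ _ hc

theorem CInv.scc_of {r : ℕ}
    (h : CInv G H r p p' (Relation.ReflTransGen R) (Relation.ReflTransGen R')) :
    CInv G H r p p' (scc R) (scc R') :=
  fun _ _ _ _ _ _ hc => and_congr (h _ _ _ _ _ _ hc) (h.symm _ _ _ _ _ _ hc)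
end CInv

section assemble
variable {V W : Type} {T : Type*} [Fintype V] [Fintype W] [Nonempty W]

open Classical in
/-- gluing bijections between classes -/
theorem assemble (Q : V → V → Prop) (Q' : W → W → Prop)
    (hQr : ∀ x, Q x x) (hQs : ∀ x y, Q x y → Q y x) (hQt : ∀ x y z, Q x y → Q y z → Q x z)
    (hQr' : ∀ x, Q' x x) (hQs' : ∀ x y, Q' x y → Q' y x)
    (hQt' : ∀ x y z, Q' x y → Q' y z → Q' x z)
    (τ : V → T) (τ' : W → T) (hτ : ∀ x y, Q x y → τ x = τ y) (hτ' : ∀ x y, Q' x y → τ' x = τ' y)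
    (A : V → V → Prop) (A' : W → W → Prop) (UU : V → W → Prop)
    (n : ℕ) : ∀ (C : Finset V) (C' : Finset W), C.card = n →
    (∀ x ∈ C, ∀ y, Q x y → y ∈ C) → (∀ x ∈ C', ∀ y, Q' x y → y ∈ C') →
    (∀ t, (C.filter (fun x => τ x = t)).card = (C'.filter (fun x => τ' x = t)).card) →
    (∀ x ∈ C, ∀ x' ∈ C', τ x = τ' x' → ∃ φ : V → W, Set.BijOn φ {y | Q x y} {y | Q' x' y} ∧
      (∀ y z, Q x y → Q x z → (A y z ↔ A' (φ y) (φ z))) ∧ ∀ y, Q x y → UU y (φ y)) →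
    ∃ φ : V → W, Set.BijOn φ C C' ∧ (∀ x ∈ C, τ' (φ x) = τ x) ∧
      (∀ x ∈ C, UU x (φ x)) ∧ (∀ x ∈ C, ∀ y ∈ C, (Q x y ↔ Q' (φ x) (φ y))) ∧
      (∀ x ∈ C, ∀ y ∈ C, Q x y → (A x y ↔ A' (φ x) (φ y))) := by
  induction n using Nat.strong_induction_on with
  | _ n ih =>
  intro C C' hn hC hC' hcard hp
  rcases C.eq_empty_or_nonempty with rfl | ⟨x, hx⟩
  · have hC'e : C' = ∅ := by
      by_contra hne
      obtain ⟨x', hx'⟩ := Finset.nonempty_iff_ne_empty.2 hne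
      have := hcard (τ' x')
      simp only [Finset.filter_empty, Finset.card_empty] at this
      have h2 : x' ∈ C'.filter (fun y => τ' y = τ' x') := by simp [hx']
      rw [Finset.card_eq_zero.1 this.symm] at h2
      simp at h2
    subst hC'e
    exact ⟨fun _ => Classical.arbitrary W, by simp [Set.BijOn, Set.MapsTo, Set.SurjOn], by simp,
      by simp, by simp, by simp⟩
  · obtain ⟨x', hx', hxx⟩ : ∃ x' ∈ C', τ' x' = τ x := by
      have h1 : 0 < (C'.filter (fun y => τ' y = τ x)).card := by
        rw [← hcard]; exact Finset.card_pos.2 ⟨x, by simp [hx]⟩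
      obtain ⟨x', h⟩ := Finset.card_pos.1 h1
      exact ⟨x', (Finset.mem_filter.1 h).1, (Finset.mem_filter.1 h).2⟩
    obtain ⟨φ, hφ, hφA, hφU⟩ := hp x hx x' hx' hxx.symm
    have hcq : (C.filter (Q x)).card = (C'.filter (Q' x')).card := by
      refine Finset.card_bij (fun y _ => φ y) ?_ ?_ ?_
      · intro y hy
        have := hφ.mapsTo (Finset.mem_filter.1 hy).2
        exact Finset.mem_filter.2 ⟨hC' _ hx' _ this, this⟩
      · intro y hy z hz h
        exact hφ.injOn (Finset.mem_filter.1 hy).2 (Finset.mem_filter.1 hz).2 h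
      · intro y' hy'
        obtain ⟨y, hy, h⟩ := hφ.surjOn (Finset.mem_filter.1 hy').2
        exact ⟨y, Finset.mem_filter.2 ⟨hC _ hx _ hy, hy⟩, h⟩
    have hfib : ∀ t, ((C.filter (fun y => ¬ Q x y)).filter (fun y => τ y = t)).card =
        ((C'.filter (fun y => ¬ Q' x' y)).filter (fun y => τ' y = t)).card := by
      intro t
      have e1 := Finset.card_filter_add_card_filter_not (s := C.filter (fun y => τ y = t)) (Q x)
      have e2 := Finset.card_filter_add_card_filter_not (s := C'.filter (fun y => τ' y = t)) (Q' x')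
      have c1 : (C.filter (fun y => ¬ Q x y)).filter (fun y => τ y = t) =
        (C.filter (fun y => τ y = t)).filter (fun y => ¬ Q x y) := by
        ext y; simp only [Finset.mem_filter]; tauto
      have c2 : (C'.filter (fun y => ¬ Q' x' y)).filter (fun y => τ' y = t) =
        (C'.filter (fun y => τ' y = t)).filter (fun y => ¬ Q' x' y) := by
        ext y; simp only [Finset.mem_filter]; tauto
      rw [c1, c2]
      have e3 := hcard t
      have e4 : ((C.filter (fun y => τ y = t)).filter (Q x)).card =
          ((C'.filter (fun y => τ' y = t)).filter (Q' x')).card := by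
        by_cases ht : τ x = t
        · have a1 : (C.filter (fun y => τ y = t)).filter (Q x) = C.filter (Q x) := by
            ext y; simp only [Finset.mem_filter]
            exact ⟨fun h => ⟨h.1.1, h.2⟩, fun h => ⟨⟨h.1, (hτ _ _ h.2).symm.trans ht⟩, h.2⟩⟩
          have a2 : (C'.filter (fun y => τ' y = t)).filter (Q' x') = C'.filter (Q' x') := by
            ext y; simp only [Finset.mem_filter]
            exact ⟨fun h => ⟨h.1.1, h.2⟩,
              fun h => ⟨⟨h.1, (hτ' _ _ h.2).symm.trans (hxx.trans ht)⟩, h.2⟩⟩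
          rw [a1, a2, hcq]
        · rw [Finset.filter_false_of_mem, Finset.filter_false_of_mem]
          · rfl
          · intro y hy hq
            exact ht (hxx.symm.trans ((hτ' _ _ hq).trans (Finset.mem_filter.1 hy).2))
          · intro y hy hq
            exact ht ((hτ _ _ hq).trans (Finset.mem_filter.1 hy).2)
      omega
    have hlt : (C.filter (fun y => ¬ Q x y)).card < n := by
      rw [← hn]
      refine Finset.card_lt_card (Finset.filter_ssubset.2 ⟨x, hx, not_not.2 (hQr x)⟩)
    obtain ⟨ψ, h1, h2, h3, h4, h5⟩ := ih _ hlt (C.filter (fun y => ¬ Q x y))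
      (C'.filter (fun y => ¬ Q' x' y)) rfl
      (by
        intro y hy z hz
        rw [Finset.mem_filter] at hy ⊢
        exact ⟨hC _ hy.1 _ hz, fun h => hy.2 (hQt _ _ _ h (hQs _ _ hz))⟩)
      (by
        intro y hy z hz
        rw [Finset.mem_filter] at hy ⊢
        exact ⟨hC' _ hy.1 _ hz, fun h => hy.2 (hQt' _ _ _ h (hQs' _ _ hz))⟩)
      hfib
      (fun y hy z hz => hp y (Finset.mem_filter.1 hy).1 z (Finset.mem_filter.1 hz).1)
    have hm : ∀ y ∈ C, ¬ Q x y → y ∈ C.filter (fun y => ¬ Q x y) :=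
      fun y hy h => Finset.mem_filter.2 ⟨hy, h⟩
    have hψm : ∀ y ∈ C, ¬ Q x y → ψ y ∈ C' ∧ ¬ Q' x' (ψ y) := fun y hy h =>
      Finset.mem_filter.1 (Finset.mem_coe.1 (h1.mapsTo (Finset.mem_coe.2 (hm y hy h))))
    have hφm : ∀ y, Q x y → Q' x' (φ y) := fun y hy => hφ.mapsTo hy
    refine ⟨fun y => if Q x y then φ y else ψ y, ⟨?_, ?_, ?_⟩, ?_, ?_, ?_, ?_⟩
    · intro y hy
      by_cases h : Q x y
      · simp only [h, if_true]; exact hC' _ hx' _ (hφm y h)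
      · simp only [h, if_false]; exact (hψm y hy h).1
    · intro y hy z hz hyz
      by_cases h : Q x y <;> by_cases h' : Q x z <;> simp only [h, h', if_true, if_false] at hyz
      · exact hφ.injOn h h' hyz
      · exact absurd (hyz ▸ hφm y h) (hψm z hz h').2
      · exact absurd (hyz ▸ hφm z h') (hψm y hy h).2
      · exact h1.injOn (hm y hy h) (hm z hz h') hyz
    · intro y' hy'
      by_cases h : Q' x' y'
      · obtain ⟨y, hy, hyy⟩ := hφ.surjOn h
        have hy' : Q x y := hy
        exact ⟨y, hC _ hx _ hy, by simp [hy', hyy]⟩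
      · obtain ⟨y, hy, hyy⟩ := h1.surjOn (Finset.mem_coe.2 (Finset.mem_filter.2 ⟨hy', h⟩))
        have hy2 := Finset.mem_filter.1 (Finset.mem_coe.1 hy)
        exact ⟨y, hy2.1, by simp [hy2.2, hyy]⟩
    · intro y hy
      by_cases h : Q x y
      · simp only [h, if_true]; rw [← hτ' _ _ (hφm y h), hxx, hτ _ _ h]
      · simp only [h, if_false]; exact h2 _ (hm y hy h)
    · intro y hy
      by_cases h : Q x y
      · simp only [h, if_true]; exact hφU _ h
      · simp only [h, if_false]; exact h3 _ (hm y hy h)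
    · intro y hy z hz
      by_cases h : Q x y <;> by_cases h' : Q x z <;> simp only [h, h', if_true, if_false]
      · exact iff_of_true (hQt _ _ _ (hQs _ _ h) h') (hQt' _ _ _ (hQs' _ _ (hφm _ h)) (hφm _ h'))
      · exact iff_of_false (fun h2 => h' (hQt _ _ _ h h2))
          (fun h2 => (hψm z hz h').2 (hQt' _ _ _ (hφm _ h) h2))
      · exact iff_of_false (fun h2 => h (hQt _ _ _ h' (hQs _ _ h2)))
          (fun h2 => (hψm y hy h).2 (hQt' _ _ _ (hφm _ h') (hQs' _ _ h2)))
      · exact h4 _ (hm y hy h) _ (hm z hz h')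
    · intro y hy z hz hq
      by_cases h : Q x y
      · have h' : Q x z := hQt _ _ _ h hq
        simp only [h, h', if_true]; exact hφA _ _ h h'
      · have h' : ¬ Q x z := fun h' => h (hQt _ _ _ h' (hQs _ _ hq))
        simp only [h, h', if_false]; exact h5 _ (hm y hy h) _ (hm z hz h') hq
end assemble

open Classical in
noncomputable def ad {V : Type} (G : SimpleGraph V) (v w : V) : ZMod 2 := if G.Adj v w then 1 else 0

theorem ad_comm {V : Type} (G : SimpleGraph V) (v w : V) : ad G v w = ad G w v := by
  unfold ad; rw [G.adj_comm]

theorem ad_eq_iff {V W : Type} (G : SimpleGraph V) (H : SimpleGraph W) (v w : V) (v' w' : W) :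
    ad G v w = ad H v' w' ↔ (G.Adj v w ↔ H.Adj v' w') := by
  unfold ad
  by_cases h : G.Adj v w <;> by_cases h' : H.Adj v' w' <;> simp [h, h']

/-- predicted adjacency -/
noncomputable def pred {V : Type} {N : ℕ} (G : SimpleGraph V) (L : Fin N → Fin N → ZMod 2)
    (p : Fin N → V) (v w : V) : ZMod 2 :=
  ∑ j, ∑ i, ad G v (p j) * L j i * ad G (p i) w

def arr {V : Type} {N : ℕ} (G : SimpleGraph V) (L : Fin N → Fin N → ZMod 2)
    (p : Fin N → V) (v w : V) : Prop := ad G v w ≠ pred G L p v w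

def UT {V W : Type} {N : ℕ} (G : SimpleGraph V) (H : SimpleGraph W) (U : Finset (Fin N))
    (p : Fin N → V) (p' : Fin N → W) (x : V) (x' : W) : Prop :=
  ∀ i ∈ U, (x = p i ↔ x' = p' i) ∧ (G.Adj x (p i) ↔ H.Adj x' (p' i))

theorem pred_congr {V W : Type} {N : ℕ} {G : SimpleGraph V} {H : SimpleGraph W}
    {U : Finset (Fin N)} {p : Fin N → V} {p' : Fin N → W} {L : Fin N → Fin N → ZMod 2}
    (hL : ∀ j i, L j i ≠ 0 → j ∈ U ∧ i ∈ U) {x y : V} {x' y' : W}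
    (hx : UT G H U p p' x x') (hy : UT G H U p p' y y') :
    pred G L p x y = pred H L p' x' y' := by
  unfold pred
  refine Finset.sum_congr rfl fun j _ => Finset.sum_congr rfl fun i _ => ?_
  by_cases h : L j i = 0
  · simp [h]
  · obtain ⟨hj, hi⟩ := hL j i h
    rw [(ad_eq_iff G H _ _ _ _).2 (hx j hj).2, ad_comm G (p i), ad_comm H (p' i),
      (ad_eq_iff G H _ _ _ _).2 (hy i hi).2]

section GLs
variable {V W : Type} [Fintype V] [DecidableEq V] [Fintype W] [DecidableEq W] {N : ℕ}
  {G : SimpleGraph V} {H : SimpleGraph W} {p : Fin N → V} {p' : Fin N → W}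

theorem C3_UT {r : ℕ} {x y z : V} {x' y' z' : W} (U : Finset (Fin N))
    (h : C3 G r p x y z = C3 H r p' x' y' z') : UT G H U p p' x x' :=
  fun i _ => ⟨C3_eqp h i, C3_adjp h i⟩

theorem CInv_arr (r : ℕ) (L : Fin N → Fin N → ZMod 2) :
    CInv G H r p p' (arr G L p) (arr H L p') := by
  intro x y z x' y' z' h
  unfold arr
  have := pred_congr (L := L) (U := Finset.univ) (fun _ _ _ => ⟨Finset.mem_univ _, Finset.mem_univ _⟩)
    (C3_UT Finset.univ h) (C3_UT Finset.univ (C3_swap12 h))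
  rw [this, (ad_eq_iff G H _ _ _ _).2 (C3_adj12 h)]

variable (G H) in
def PIso (C : Set V) (C' : Set W) (U : Finset (Fin N)) (p : Fin N → V) (p' : Fin N → W) : Prop :=
  ∃ φ : V → W, Set.BijOn φ C C' ∧ (∀ x ∈ C, ∀ y ∈ C, (G.Adj x y ↔ H.Adj (φ x) (φ y))) ∧
    ∀ x ∈ C, UT G H U p p' x (φ x)

open Classical in
noncomputable def Om {V : Type} [Fintype V] (D : V → V → Prop) (x : V) : ℕ :=
  (Finset.univ.filter (Relation.ReflTransGen D x)).card

theorem Om_scc {V : Type} [Fintype V] {D : V → V → Prop} {x y : V} (h : scc D x y) :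
    Om D x = Om D y := by
  classical
  unfold Om
  congr 1
  ext z
  simp only [Finset.mem_filter, Finset.mem_univ, true_and]
  exact ⟨fun hz => h.2.trans hz, fun hz => h.1.trans hz⟩

theorem Om_le {V : Type} [Fintype V] {D : V → V → Prop} {x y : V}
    (h : Relation.ReflTransGen D x y) : Om D y ≤ Om D x := by
  classical
  refine Finset.card_le_card fun z hz => ?_
  simp only [Finset.mem_filter, Finset.mem_univ, true_and] at hz ⊢
  exact h.trans hz

theorem Om_lt {V : Type} [Fintype V] {D : V → V → Prop} {x y : V}
    (h : Relation.ReflTransGen D x y) (hn : ¬ Relation.ReflTransGen D y x) : Om D y < Om D x := by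
  classical
  refine Finset.card_lt_card (Finset.ssubset_iff_subset_ne.2 ⟨fun z hz => ?_, fun he => hn ?_⟩)
  · simp only [Finset.mem_filter, Finset.mem_univ, true_and] at hz ⊢
    exact h.trans hz
  · have : x ∈ Finset.univ.filter (Relation.ReflTransGen D x) := by simp [Relation.ReflTransGen.refl]
    rw [← he] at this
    simpa using this

theorem cross {D : V → V → Prop} {L : Fin N → Fin N → ZMod 2} {x y : V}
    (h1 : ad G x y ≠ pred G L p x y → D x y) (h2 : ad G y x ≠ pred G L p y x → D y x)
    (hn : ¬ scc D x y) :
    ad G x y = if Om D y < Om D x then pred G L p y x else pred G L p x y := by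
  split_ifs with h
  · by_contra hc
    rw [ad_comm] at hc
    have := Om_le (.single (h2 hc))
    omega
  · by_contra hc
    have h3 := h1 hc
    exact h (Om_lt (.single h3) fun h4 => hn ⟨.single h3, h4⟩)

theorem Om_inv {r : ℕ} {D : V → V → Prop} {D' : W → W → Prop}
    (hD : CInv G H r p p' (Relation.ReflTransGen D) (Relation.ReflTransGen D')) {x y z : V} {x' y' z' : W}
    (h : C3 G (r + 1) p x y z = C3 H (r + 1) p' x' y' z') : Om D x = Om D' x' := by
  classical
  obtain ⟨f, hf, _⟩ := C3_step h
  refine Finset.card_equiv f fun w => ?_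
  simp only [Finset.mem_filter, Finset.mem_univ, true_and]
  exact hD _ _ _ _ _ _ (C3_swap23 (hf w))

theorem scc_back {r : ℕ} {D : V → V → Prop} {D' : W → W → Prop}
    (hD : CInv G H r p p' (Relation.ReflTransGen D) (Relation.ReflTransGen D')) {x : V} {x' : W}
    (h : C3 G (r + 3) p x x x = C3 H (r + 3) p' x' x' x') :
    ∃ f : V ≃ W, ∀ y, (scc D x y ↔ scc D' x' (f y)) ∧ C3 G r p y y y = C3 H r p' (f y) (f y) (f y) := by
  obtain ⟨f, hf, _⟩ := C3_step (r := r + 2) h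
  exact ⟨f, fun y => ⟨(hD.mono (by omega : r ≤ r + 2)).scc_of _ _ _ _ _ _ (C3_swap23 (hf y)),
    C3_diag (hf y)⟩⟩

theorem glue_lemma {r : ℕ} (D : V → V → Prop) (D' : W → W → Prop)
    (hD : CInv G H r p p' (Relation.ReflTransGen D) (Relation.ReflTransGen D'))
    (C : Set V) (C' : Set W) (hC : ∀ x ∈ C, ∀ y, scc D x y → y ∈ C)
    (hC' : ∀ x ∈ C', ∀ y, scc D' x y → y ∈ C')
    (f : V ≃ W) (hfC : ∀ x, x ∈ C ↔ f x ∈ C')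
    (hf : ∀ x ∈ C, C3 G (r + 4) p x x x = C3 H (r + 4) p' (f x) (f x) (f x))
    (L : Fin N → Fin N → ZMod 2) (U : Finset (Fin N)) (hL : ∀ j i, L j i ≠ 0 → j ∈ U ∧ i ∈ U)
    (hp : ∀ x ∈ C, ∀ x' ∈ C', C3 G (r + 1) p x x x = C3 H (r + 1) p' x' x' x' →
      PIso G H {y | scc D x y} {y | scc D' x' y} U p p')
    (hE : ∀ x ∈ C, ∀ y ∈ C, arr G L p x y → D x y)
    (hE' : ∀ x ∈ C', ∀ y ∈ C', arr H L p' x y → D' x y) [Nonempty W] :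
    PIso G H C C' U p p' := by
  classical
  let τ : V → Set (WLColorType (N + 3) Unit (r + 1)) := fun x => {c | ∃ y, scc D x y ∧ c = C3 G (r + 1) p y y y}
  let τ' : W → Set (WLColorType (N + 3) Unit (r + 1)) := fun x => {c | ∃ y, scc D' x y ∧ c = C3 H (r + 1) p' y y y}
  have hτf : ∀ x ∈ C, τ x = τ' (f x) := by
    intro x hx
    obtain ⟨g, hg⟩ := scc_back (hD.mono (by omega : r ≤ r + 1)) (hf x hx)
    ext c
    constructor
    · rintro ⟨y, hy, rfl⟩
      exact ⟨g y, (hg y).1.1 hy, (hg y).2⟩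
    · rintro ⟨y', hy, rfl⟩
      refine ⟨g.symm y', (hg _).1.2 (by simpa using hy), ?_⟩
      rw [(hg _).2, g.apply_symm_apply]
  have hget : ∀ x x', τ x = τ' x' → ∃ y', scc D' x' y' ∧ C3 G (r + 1) p x x x = C3 H (r + 1) p' y' y' y' := by
    intro x x' h
    have : C3 G (r + 1) p x x x ∈ τ' x' := by
      rw [← h]; exact ⟨x, scc_refl _ _, rfl⟩
    exact this
  obtain ⟨φ, h1, h2, h3, h4, h5⟩ := assemble (scc D) (scc D') (scc_refl D)
    (fun _ _ => scc_symm) (fun _ _ _ => scc_trans) (scc_refl D') (fun _ _ => scc_symm)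
    (fun _ _ _ => scc_trans) τ τ'
    (by
      intro x y h
      ext c
      exact ⟨fun ⟨z, hz, hc⟩ => ⟨z, scc_trans (scc_symm h) hz, hc⟩,
        fun ⟨z, hz, hc⟩ => ⟨z, scc_trans h hz, hc⟩⟩)
    (by
      intro x y h
      ext c
      exact ⟨fun ⟨z, hz, hc⟩ => ⟨z, scc_trans (scc_symm h) hz, hc⟩,
        fun ⟨z, hz, hc⟩ => ⟨z, scc_trans h hz, hc⟩⟩)
    G.Adj H.Adj (UT G H U p p') _ (Finset.univ.filter (· ∈ C)) (Finset.univ.filter (· ∈ C')) rfl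
    (by intro x hx y hy; simp only [Finset.mem_filter, Finset.mem_univ, true_and] at hx ⊢; exact hC x hx y hy)
    (by intro x hx y hy; simp only [Finset.mem_filter, Finset.mem_univ, true_and] at hx ⊢; exact hC' x hx y hy)
    (by
      intro t
      refine Finset.card_equiv f fun x => ?_
      simp only [Finset.mem_filter, Finset.mem_univ, true_and]
      rw [← hfC]
      exact and_congr_right fun hx => by rw [hτf x hx])
    (by
      intro x hx x' hx' h
      simp only [Finset.mem_filter, Finset.mem_univ, true_and] at hx hx'
      obtain ⟨y', hy', hc⟩ := hget x x' h
      obtain ⟨φ, a, b, c⟩ := hp x hx y' (hC' _ hx' _ hy') hc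
      have he : {y | scc D' x' y} = {y | scc D' y' y} := by
        ext z; exact ⟨fun h => scc_trans (scc_symm hy') h, fun h => scc_trans hy' h⟩
      rw [he]
      exact ⟨φ, a, fun y z hy hz => b y hy z hz, c⟩)
  simp only [Finset.coe_filter, Finset.mem_univ, true_and, Finset.mem_filter] at h1 h2 h3 h4 h5
  have hm : ∀ x ∈ C, φ x ∈ C' := fun x hx => h1.mapsTo hx
  refine ⟨φ, h1, fun x hx y hy => ?_, fun x hx => h3 x hx⟩
  by_cases hq : scc D x y
  · exact h5 x hx y hy hq
  · have hq' : ¬ scc D' (φ x) (φ y) := fun h => hq ((h4 x hx y hy).2 h)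
    have hOm : ∀ z ∈ C, Om D z = Om D' (φ z) := by
      intro z hz
      obtain ⟨y', hy', hc⟩ := hget z (φ z) (h2 z hz).symm
      rw [Om_inv hD hc, Om_scc hy']
    rw [← ad_eq_iff, cross (hE x hx y hy) (hE y hy x hx) hq,
      cross (hE' _ (hm x hx) _ (hm y hy)) (hE' _ (hm y hy) _ (hm x hx)) hq',
      pred_congr hL (h3 x hx) (h3 y hy), pred_congr hL (h3 y hy) (h3 x hx), hOm x hx, hOm y hy]

end GLs

section LA
variable {V : Type} [Fintype V]

theorem span_fun {α M : Type} [Fintype α] [AddCommGroup M] [Module (ZMod 2) M] (f : α → M)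
    (S : Set α) (x : M) (hx : x ∈ Submodule.span (ZMod 2) (f '' S)) :
    ∃ c : α → ZMod 2, (∀ a, c a ≠ 0 → a ∈ S) ∧ x = ∑ a, c a • f a := by
  classical
  refine Submodule.span_induction (p := fun x _ => ∃ c : α → ZMod 2, (∀ a, c a ≠ 0 → a ∈ S) ∧ x = ∑ a, c a • f a)
    ?_ ?_ ?_ ?_ hx
  · rintro _ ⟨a, ha, rfl⟩
    refine ⟨fun b => if b = a then 1 else 0, fun b hb => ?_, by simp⟩
    by_cases h : b = a
    · exact h ▸ ha
    · simp [h] at hb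
  · exact ⟨0, by simp, by simp⟩
  · rintro _ _ _ _ ⟨c, hc, rfl⟩ ⟨d, hd, rfl⟩
    refine ⟨c + d, fun a ha => ?_, by simp [add_smul, Finset.sum_add_distrib]⟩
    by_contra hn
    exact ha (by rw [Pi.add_apply, not_not.1 (mt (hc a) hn), not_not.1 (mt (hd a) hn), add_zero])
  · rintro t _ _ ⟨c, hc, rfl⟩
    refine ⟨t • c, fun a ha => hc a fun h => ha (by simp [h]), ?_⟩
    simp [Finset.smul_sum, mul_smul]

theorem greedy {M : Type} [AddCommGroup M] [Module (ZMod 2) M] (f : V → M) (X A0 : Set V)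
    (ρ : V → ℕ) (hA : A0 ⊆ X) (hl : LinearIndepOn (ZMod 2) f A0) :
    ∃ A1 : Set V, A0 ⊆ A1 ∧ A1 ⊆ X ∧ LinearIndepOn (ZMod 2) f A1 ∧
      ∀ v ∈ X, ∃ lam : V → ZMod 2, (∀ a, lam a ≠ 0 → a ∈ A1 ∧ (a ∈ A0 ∨ ρ a ≤ ρ v)) ∧
        f v = ∑ a, lam a • f a := by
  have key : ∀ n : ℕ, ∃ S : Set V, A0 ⊆ S ∧ S ⊆ X ∧ LinearIndepOn (ZMod 2) f S ∧
      (∀ a ∈ S, a ∈ A0 ∨ ρ a < n) ∧ ∀ v ∈ X, ρ v < n →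
        f v ∈ Submodule.span (ZMod 2) (f '' {a | a ∈ S ∧ (a ∈ A0 ∨ ρ a ≤ ρ v)}) := by
    intro n
    induction n with
    | zero => exact ⟨A0, subset_rfl, hA, hl, fun a ha => Or.inl ha, fun v _ h => absurd h (Nat.not_lt_zero _)⟩
    | succ n ih =>
      obtain ⟨S, h1, h2, h3, h4, h5⟩ := ih
      obtain ⟨b, hb1, hb2, hb3, hb4⟩ := exists_linearIndepOn_extension h3
        (Set.subset_union_left : S ⊆ S ∪ {v | v ∈ X ∧ ρ v ≤ n})
      have hb : ∀ a ∈ b, a ∈ A0 ∨ ρ a < n + 1 := by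
        intro a ha
        rcases hb1 ha with h | h
        · exact (h4 a h).imp id (fun h => by omega)
        · exact Or.inr (Nat.lt_succ_of_le h.2)
      refine ⟨b, h1.trans hb2, fun a ha => ?_, hb4, hb, fun v hv hvn => ?_⟩
      · rcases hb1 ha with h | h
        · exact h2 h
        · exact h.1
      · by_cases hlt : ρ v < n
        · refine Submodule.span_mono (Set.image_mono ?_) (h5 v hv hlt)
          exact fun a ha => ⟨hb2 ha.1, ha.2⟩
        · have : f v ∈ Submodule.span (ZMod 2) (f '' b) :=
            hb3 ⟨v, Or.inr ⟨hv, by omega⟩, rfl⟩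
          refine Submodule.span_mono (Set.image_mono ?_) this
          exact fun a ha => ⟨ha, (hb a ha).imp id fun h => by omega⟩
  obtain ⟨S, h1, h2, h3, _, h5⟩ := key (∑ v, ρ v + 1)
  refine ⟨S, h1, h2, h3, fun v hv => ?_⟩
  have hle : ρ v ≤ ∑ v, ρ v := Finset.single_le_sum (fun _ _ => Nat.zero_le _) (Finset.mem_univ v)
  exact span_fun f _ _ (h5 v hv (by omega))

theorem card_le_rank {ι : Type} [Fintype ι] (M : Matrix V V (ZMod 2)) (b : ι → V → ZMod 2)
    (hb : LinearIndependent (ZMod 2) b) (h : ∀ i, ∃ v, b i = M v) : Fintype.card ι ≤ M.rank := by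
  rw [Matrix.rank_eq_finrank_span_row, ← finrank_span_eq_card hb]
  refine Submodule.finrank_mono (Submodule.span_mono ?_)
  rintro _ ⟨i, rfl⟩
  obtain ⟨v, hv⟩ := h i
  exact ⟨v, hv.symm⟩

/-- dual functionals -/
theorem dual_fun (b : V → V → ZMod 2) (S : Finset V) (hb : LinearIndepOn (ZMod 2) b S) :
    ∃ μ : V → V → ZMod 2, ∀ a ∈ S, ∀ lam : V → ZMod 2, (∀ a, lam a ≠ 0 → a ∈ S) →
      lam a = ∑ w, μ a w * ∑ a', lam a' * b a' w := by
  classical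
  let F : (S → ZMod 2) →ₗ[ZMod 2] (V → ZMod 2) := Fintype.linearCombination (ZMod 2) (fun a : S => b a)
  have hF : F.ker = ⊥ := by
    have : LinearIndependent (ZMod 2) (fun a : S => b a) := hb
    rw [Fintype.linearIndependent_iff] at this
    rw [LinearMap.ker_eq_bot']
    intro m hm
    funext i
    exact this m (by simpa [F, Fintype.linearCombination_apply] using hm) i
  obtain ⟨g, hg⟩ := LinearMap.exists_leftInverse_of_injective F hF
  refine ⟨fun a w => if ha : a ∈ S then g (fun j => if w = j then 1 else 0) ⟨a, ha⟩ else 0, ?_⟩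
  intro a ha lam hlam
  have h1 : g (F (fun a => lam a)) = fun a : S => lam a := LinearMap.congr_fun hg _
  have h2 := congrFun h1 ⟨a, ha⟩
  rw [LinearMap.pi_apply_eq_sum_univ g] at h2
  simp only [Finset.sum_apply, Pi.smul_apply, smul_eq_mul] at h2
  rw [← h2]
  refine Finset.sum_congr rfl fun w _ => ?_
  show _ = (if ha : a ∈ S then g (fun j => if w = j then 1 else 0) ⟨a, ha⟩ else 0) * _
  rw [dif_pos ha, mul_comm]
  congr 1
  simp only [F, Fintype.linearCombination_apply, Finset.sum_apply, Pi.smul_apply, smul_eq_mul]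
  rw [Finset.sum_coe_sort S (fun a => lam a * b a w)]
  refine Finset.sum_subset (Finset.subset_univ _) fun a _ ha => ?_
  rw [not_not.1 (mt (hlam a) ha), zero_mul]

end LA

section CR
variable {V : Type} [Fintype V] [DecidableEq V] (G : SimpleGraph V)

noncomputable def MX (X : Finset V) : Matrix V V (ZMod 2) :=
  Matrix.of fun v w => if v ∈ X ∧ w ∉ X then ad G v w else 0

noncomputable def cr (X : Finset V) : ℕ := (MX G X).rank

noncomputable def rowX (X : Finset V) (v : V) : V → ZMod 2 := fun w => if w ∈ X then 0 else ad G v w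

theorem rowX_card (X S : Finset V) (hS : S ⊆ X) (h : LinearIndepOn (ZMod 2) (rowX G X) S) :
    S.card ≤ cr G X := by
  have := card_le_rank (MX G X) (fun v : S => rowX G X v) h (fun v => ⟨v, by
    funext w
    have : (v : V) ∈ X := hS v.2
    simp [MX, rowX, this]⟩)
  simpa [cr] using this

theorem side (X : Finset V) (ρ : V → ℕ) (A0 : Finset V) (hA : A0 ⊆ X)
    (hl : LinearIndepOn (ZMod 2) (rowX G X) A0) :
    ∃ (A1 : Finset V) (lam μ : V → V → ZMod 2), A0 ⊆ A1 ∧ A1 ⊆ X ∧ A1.card ≤ cr G X ∧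
      LinearIndepOn (ZMod 2) (rowX G X) A1 ∧
      (∀ v ∈ X, ∀ a, lam v a ≠ 0 → a ∈ A1 ∧ (a ∈ A0 ∨ ρ a ≤ ρ v)) ∧
      (∀ v ∈ X, ∀ w, w ∉ X → ad G v w = ∑ a, lam v a * ad G a w) ∧
      (∀ v ∈ X, ∀ a ∈ A1, lam v a = ∑ w ∈ Xᶜ, μ a w * ad G v w) := by
  classical
  obtain ⟨A, h1, h2, h3, h4⟩ := greedy (rowX G X) X A0 ρ (by exact_mod_cast hA) hl
  have hA1 : (A.toFinset : Set V) = A := by simp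
  have h4' : ∀ v, ∃ lam : V → ZMod 2, v ∈ X → (∀ a, lam a ≠ 0 → a ∈ A ∧ (a ∈ A0 ∨ ρ a ≤ ρ v)) ∧
        rowX G X v = ∑ a, lam a • rowX G X a := by
    intro v
    by_cases hv : v ∈ X
    · obtain ⟨l, hl⟩ := h4 v hv
      exact ⟨l, fun _ => hl⟩
    · exact ⟨0, fun h => absurd h hv⟩
  choose lam hlam using h4'
  obtain ⟨μ, hμ⟩ := dual_fun (rowX G X) A.toFinset (by rw [hA1]; exact h3)
  have hrow : ∀ v ∈ X, ∀ w, rowX G X v w = ∑ a, lam v a * rowX G X a w := by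
    intro v hv w
    have := congrFun (hlam v hv).2 w
    simpa using this
  have hsub : A.toFinset ⊆ X := fun a ha => h2 (by simpa using ha)
  refine ⟨A.toFinset, lam, μ, fun a ha => by simpa using h1 ha, hsub, ?_, ?_, ?_, ?_, ?_⟩
  · exact rowX_card G X _ hsub (by rw [hA1]; exact h3)
  · rw [hA1]; exact h3
  · intro v hv a ha
    have := (hlam v hv).1 a ha
    exact ⟨by simpa using this.1, this.2⟩
  · intro v hv w hw
    have := hrow v hv w
    simpa [rowX, hw] using this
  · intro v hv a ha
    rw [hμ a ha (lam v) (fun b hb => by simpa using ((hlam v hv).1 b hb).1)]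
    rw [← Finset.sum_subset (Finset.subset_univ Xᶜ)]
    · refine Finset.sum_congr rfl fun w hw => ?_
      rw [← hrow v hv w]
      have : w ∉ X := by simpa using hw
      simp [rowX, this]
    · intro w _ hw
      have : w ∈ X := by simpa using hw
      simp [rowX, this]

theorem cols {N : ℕ} (X : Finset V) (q : Fin N → V) (J : Finset (Fin N)) (hJ : ∀ j ∈ J, q j ∉ X)
    (hs : ∀ w, w ∉ X → ∃ c : Fin N → ZMod 2, ∀ v ∈ X, ad G v w = ∑ j ∈ J, c j * ad G v (q j)) :
    ∃ J1 ⊆ J, J1.card ≤ cr G X ∧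
      ∀ w, w ∉ X → ∃ c : Fin N → ZMod 2, (∀ j, c j ≠ 0 → j ∈ J1) ∧
        ∀ v ∈ X, ad G v w = ∑ j, c j * ad G v (q j) := by
  classical
  let f : Fin N → V → ZMod 2 := fun j v => if v ∈ X then ad G v (q j) else 0
  obtain ⟨b, hb1, _, hb3, hb4⟩ := exists_linearIndepOn_extension (v := f) (t := (J : Set (Fin N)))
    (linearIndepOn_empty (ZMod 2) f) (Set.empty_subset _)
  have hbc : (b.toFinset : Set (Fin N)) = b := by simp
  have hbJ : b.toFinset ⊆ J := fun j hj => hb1 (by simpa using hj)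
  refine ⟨b.toFinset, hbJ, ?_, ?_⟩
  · have hl : LinearIndepOn (ZMod 2) f (b.toFinset : Set (Fin N)) := by rw [hbc]; exact hb4
    have := card_le_rank (MX G X).transpose (fun v : b.toFinset => f v) hl (fun j => ⟨q j, by
      funext v
      have : q j ∉ X := hJ _ (hbJ j.2)
      by_cases hv : v ∈ X <;> simp [MX, f, this, hv]⟩)
    rw [Matrix.rank_transpose] at this
    simpa [cr] using this
  · intro w hw
    obtain ⟨c, hc⟩ := hs w hw
    have hmem : (fun v => if v ∈ X then ad G v w else 0) ∈ Submodule.span (ZMod 2) (f '' b) := by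
      have : (fun v => if v ∈ X then ad G v w else 0) = ∑ j ∈ J, c j • f j := by
        funext v
        by_cases hv : v ∈ X
        · simp [f, hv, hc v hv]
        · simp [f, hv]
      rw [this]
      exact Submodule.sum_mem _ fun j hj => Submodule.smul_mem _ _ (hb3 ⟨j, hj, rfl⟩)
    obtain ⟨d, hd1, hd2⟩ := span_fun f b _ hmem
    refine ⟨d, fun j hj => by simpa using hd1 j hj, fun v hv => ?_⟩
    have := congrFun hd2 v
    simpa [f, hv] using this
end CR

section Cfg
variable {V : Type} [Fintype V] [DecidableEq V] {N : ℕ}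

structure Cfg (G : SimpleGraph V) (X : Finset V) (K : ℕ) (p : Fin N → V) (ia ib : Finset (Fin N))
    (L : Fin N → Fin N → ZMod 2) : Prop where
  ma : ∀ i ∈ ia, p i ∈ X
  mb : ∀ j ∈ ib, p j ∉ X
  supp : ∀ j i, L j i ≠ 0 → j ∈ ib ∧ i ∈ ia
  ind : ∀ c : Fin N → ZMod 2, (∀ w, w ∉ X → ∑ i ∈ ia, c i * ad G (p i) w = 0) → ∀ i ∈ ia, c i = 0
  expl : ∀ v ∈ X, ∀ w, w ∉ X → ad G v w = pred G L p v w
  ca : ia.card ≤ K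
  cb : ib.card ≤ K

variable {G : SimpleGraph V} {X X1 X2 : Finset V} {K : ℕ} {p q : Fin N → V}
  {ia ib ia1 ib1 ia2 ib2 : Finset (Fin N)} {L L1 : Fin N → Fin N → ZMod 2}

noncomputable def l0 (G : SimpleGraph V) (L : Fin N → Fin N → ZMod 2) (p : Fin N → V) (v : V) (i : Fin N) :
    ZMod 2 := ∑ j, ad G v (p j) * L j i

theorem pred_l0 (v w : V) : pred G L p v w = ∑ i, l0 G L p v i * ad G (p i) w := by
  unfold pred l0
  rw [Finset.sum_comm]
  simp [Finset.sum_mul]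

theorem Cfg.pred_ia (h : Cfg G X K p ia ib L) (v w : V) :
    pred G L p v w = ∑ i ∈ ia, l0 G L p v i * ad G (p i) w := by
  rw [pred_l0]
  refine (Finset.sum_subset (Finset.subset_univ ia) fun i _ hi => ?_).symm
  have : l0 G L p v i = 0 := Finset.sum_eq_zero fun j _ => by
    have : L j i = 0 := by
      by_contra hc; exact hi (h.supp j i hc).2
    simp [this]
  simp [this]

theorem Cfg.arr_mem (h : Cfg G X K p ia ib L) {v w : V} (hv : v ∈ X) (ha : arr G L p v w) : w ∈ X := by
  by_contra hw
  exact ha (h.expl v hv w hw)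

theorem Cfg.reach_mem (h : Cfg G X K p ia ib L) {v w : V} (hv : v ∈ X)
    (ha : Relation.ReflTransGen (arr G L p) v w) : w ∈ X := by
  induction ha with
  | refl => exact hv
  | tail _ h2 ih => exact h.arr_mem ih h2

theorem Cfg.lin (h : Cfg G X K p ia ib L) (d : V → ZMod 2) (hd : ∀ a, d a ≠ 0 → a ∈ X)
    (h0 : ∀ w, w ∉ X → ∑ a, d a * ad G a w = 0) (w : V) : ∑ a, d a * pred G L p a w = 0 := by
  have e : ∀ w, ∑ a, d a * pred G L p a w = ∑ i ∈ ia, (∑ a, d a * l0 G L p a i) * ad G (p i) w := by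
    intro w
    simp only [h.pred_ia, Finset.mul_sum, Finset.sum_mul]
    rw [Finset.sum_comm]
    refine Finset.sum_congr rfl fun i _ => Finset.sum_congr rfl fun a _ => by ring
  have := h.ind (fun i => ∑ a, d a * l0 G L p a i) (fun w hw => by
    rw [← e w, ← h0 w hw]
    refine Finset.sum_congr rfl fun a _ => ?_
    by_cases hda : d a = 0
    · simp [hda]
    · rw [h.expl a (hd a hda) w hw])
  rw [e w]
  exact Finset.sum_eq_zero fun i hi => by rw [this i hi, zero_mul]

theorem Cfg.base (h : Cfg G X K p ia ib L) {i : Fin N} (hi : i ∈ ia) (w : V) :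
    ad G (p i) w = pred G L p (p i) w := by
  have := h.ind (fun i' => l0 G L p (p i) i' - if i' = i then 1 else 0) (fun w hw => by
    simp only [sub_mul, Finset.sum_sub_distrib, ite_mul, one_mul, zero_mul]
    rw [← h.pred_ia, ← h.expl _ (h.ma i hi) w hw]
    simp [hi])
  rw [h.pred_ia]
  have h2 : ∀ i' ∈ ia, l0 G L p (p i) i' * ad G (p i') w = if i' = i then ad G (p i) w else 0 := by
    intro i' hi'
    rw [sub_eq_zero.1 (this i' hi')]
    by_cases hh : i' = i
    · subst hh; simp
    · simp [hh]
  rw [Finset.sum_congr rfl h2]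
  simp [hi]

theorem Cfg.inj (h : Cfg G X K p ia ib L) : Set.InjOn p ia := by
  intro i hi i' hi' he
  by_contra hne
  have := h.ind (fun l => (if l = i then 1 else 0) - if l = i' then 1 else 0) (fun w _ => by
    simp only [sub_mul, Finset.sum_sub_distrib, ite_mul, one_mul, zero_mul]
    simp [Finset.mem_coe.1 hi, Finset.mem_coe.1 hi', he]) i hi
  simp [hne] at this

theorem Cfg.li (h : Cfg G X K p ia ib L) (h1 : X1 ⊆ X) :
    LinearIndepOn (ZMod 2) (rowX G X1) ((ia.image p).filter (· ∈ X1) : Finset V) := by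
  have : (((ia.image p).filter (· ∈ X1) : Finset V) : Set V) = p '' ((ia.filter (p · ∈ X1) : Finset (Fin N)) : Set (Fin N)) := by
    ext v
    simp only [Finset.coe_filter, Finset.mem_image, Set.mem_ofPred_eq, Set.mem_image]
    constructor
    · rintro ⟨⟨i, hi, rfl⟩, h⟩; exact ⟨i, ⟨hi, h⟩, rfl⟩
    · rintro ⟨i, ⟨hi, h⟩, rfl⟩; exact ⟨⟨i, hi, rfl⟩, h⟩
  rw [this]
  refine LinearIndepOn.image_of_comp (s := ((ia.filter (p · ∈ X1) : Finset (Fin N)) : Set (Fin N))) p _ ?_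
  rw [linearIndepOn_finset_iff]
  intro f hf i hi
  rw [Finset.mem_filter] at hi
  have := h.ind (fun i => if p i ∈ X1 then f i else 0) (fun w hw => by
    have hw1 : w ∉ X1 := fun h => hw (h1 h)
    have := congrFun hf w
    simp only [Finset.sum_apply, Pi.smul_apply, Function.comp, rowX, hw1, if_false, smul_eq_mul, Pi.zero_apply] at this
    refine Eq.trans ?_ this
    rw [Finset.sum_filter]
    refine Finset.sum_congr rfl fun i _ => by split_ifs <;> simp) i hi.1
  simpa [hi.2] using this

theorem extend_side (hc : Cfg G X K p ia ib L) (h1 : X1 ⊆ X) (hK : cr G X1 ≤ K) (ρ : V → ℕ)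
    (hρ1 : ∀ v w, arr G L p v w → ρ w ≤ ρ v) (hρ2 : ∀ v w, ρ v = ρ w → scc (arr G L p) v w)
    (A1 : Finset V) (lam μ : V → V → ZMod 2) (hAX : A1 ⊆ X1) (hAc : A1.card ≤ cr G X1)
    (hAl : LinearIndepOn (ZMod 2) (rowX G X1) A1)
    (hl1 : ∀ v ∈ X1, ∀ a, lam v a ≠ 0 → a ∈ A1 ∧ (a ∈ (ia.image p).filter (· ∈ X1) ∨ ρ a ≤ ρ v))
    (hl2 : ∀ v ∈ X1, ∀ w, w ∉ X1 → ad G v w = ∑ a, lam v a * ad G a w)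
    (hl3 : ∀ v ∈ X1, ∀ a ∈ A1, lam v a = ∑ w ∈ X1ᶜ, μ a w * ad G v w)
    (hinj : Set.InjOn q ia1) (him : ia1.image q = A1)
    (J : Finset (Fin N)) (hJ : ∀ j ∈ J, q j ∉ X1)
    (hs : ∀ w, w ∉ X1 → ∃ c : Fin N → ZMod 2, ∀ v ∈ X1, ad G v w = ∑ j ∈ J, c j * ad G v (q j)) :
    ∃ ib1 L1, ib1 ⊆ J ∧ Cfg G X1 K q ia1 ib1 L1 ∧
      ∀ v ∈ X1, ∀ w, scc (arr G L1 q) v w → scc (arr G L p) v w := by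
  classical
  obtain ⟨ib1, hib, hibc, hcol⟩ := cols G X1 q J hJ hs
  have hcol' : ∀ w, ∃ c : Fin N → ZMod 2, w ∉ X1 → (∀ j, c j ≠ 0 → j ∈ ib1) ∧
        ∀ v ∈ X1, ad G v w = ∑ j, c j * ad G v (q j) := by
    intro w
    by_cases hw : w ∈ X1
    · exact ⟨0, fun h => absurd hw h⟩
    · obtain ⟨c, hc⟩ := hcol w hw
      exact ⟨c, fun _ => hc⟩
  choose c hcc using hcol'
  let κ : V → Fin N → ZMod 2 := fun a j => ∑ w ∈ X1ᶜ, μ a w * c w j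
  have hκ0 : ∀ a j, κ a j ≠ 0 → j ∈ ib1 := by
    intro a j h
    obtain ⟨w, hw, hne⟩ := Finset.exists_ne_zero_of_sum_ne_zero h
    exact (hcc w (by simpa using hw)).1 j (fun h => hne (by rw [h, mul_zero]))
  have hκ : ∀ v ∈ X1, ∀ a ∈ A1, lam v a = ∑ j, ad G v (q j) * κ a j := by
    intro v hv a ha
    rw [hl3 v hv a ha]
    simp only [κ, Finset.mul_sum]
    rw [Finset.sum_comm]
    refine Finset.sum_congr rfl fun w hw => ?_
    rw [(hcc w (by simpa using hw)).2 v hv, Finset.mul_sum]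
    exact Finset.sum_congr rfl fun j _ => by ring
  let L1 : Fin N → Fin N → ZMod 2 := fun j i => if i ∈ ia1 then κ (q i) j else 0
  have hmem : ∀ i ∈ ia1, q i ∈ A1 := fun i hi => him ▸ Finset.mem_image_of_mem q hi
  have hpred : ∀ v ∈ X1, ∀ w, pred G L1 q v w = ∑ a, lam v a * ad G a w := by
    intro v hv w
    rw [pred_l0]
    have e1 : ∀ i, l0 G L1 q v i * ad G (q i) w = if i ∈ ia1 then lam v (q i) * ad G (q i) w else 0 := by
      intro i
      by_cases hi : i ∈ ia1
      · simp only [l0, L1, hi, if_true]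
        rw [hκ v hv _ (hmem i hi)]
      · simp [l0, L1, hi]
    rw [Finset.sum_congr rfl fun i _ => e1 i, ← Finset.sum_filter, Finset.filter_mem_eq_inter,
      Finset.univ_inter, ← Finset.sum_image (f := fun a => lam v a * ad G a w) hinj, him]
    refine Finset.sum_subset (Finset.subset_univ _) fun a _ ha => ?_
    rw [not_not.1 (mt (fun h => (hl1 v hv a h).1) ha), zero_mul]
  have hcfg : Cfg G X1 K q ia1 ib1 L1 := by
    refine ⟨fun i hi => hAX (hmem i hi), fun j hj => hJ j (hib hj), ?_, ?_, ?_, ?_, hibc.trans hK⟩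
    · intro j i h
      by_cases hi : i ∈ ia1
      · exact ⟨hκ0 (q i) j (by simpa [L1, hi] using h), hi⟩
      · simp [L1, hi] at h
    · intro d hd
      have h2 : LinearIndepOn (ZMod 2) (rowX G X1 ∘ q) (ia1 : Set (Fin N)) := by
        refine LinearIndepOn.comp_of_image ?_ hinj
        rw [← Finset.coe_image, him]; exact hAl
      rw [linearIndepOn_finset_iff] at h2
      refine h2 d ?_
      funext w
      by_cases hw : w ∈ X1
      · simp [rowX, hw]
      · simpa [rowX, hw] using hd w hw
    · intro v hv w hw
      rw [hpred v hv w, hl2 v hv w hw]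
    · rw [← Finset.card_image_of_injOn hinj, him]; exact hAc.trans hK
  refine ⟨ib1, L1, hib, hcfg, ?_⟩
  have hstep : ∀ v ∈ X1, ∀ w, arr G L1 q v w → ρ w ≤ ρ v := by
    intro v hv w hvw
    by_contra hlt
    have hn : ∀ a, ρ a ≤ ρ v → ad G a w = pred G L p a w := by
      intro a ha
      by_contra h
      have := hρ1 a w h
      omega
    apply hvw
    rw [hpred v hv w]
    have hlin := hc.lin (fun a => (if a = v then 1 else 0) - lam v a) (fun a ha => by
        by_cases hav : a = v
        · exact hav ▸ h1 hv
        · exact h1 (hAX (hl1 v hv a (fun h => ha (by simp [hav, h]))).1)) (fun u hu => by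
        have hu1 : u ∉ X1 := fun h => hu (h1 h)
        simp only [sub_mul, Finset.sum_sub_distrib, ite_mul, one_mul, zero_mul]
        rw [← hl2 v hv u hu1]
        simp) w
    simp only [sub_mul, Finset.sum_sub_distrib, ite_mul, one_mul, zero_mul, Finset.sum_ite_eq',
      Finset.mem_univ, if_true] at hlin
    rw [hn v le_rfl, sub_eq_zero.1 hlin]
    refine Finset.sum_congr rfl fun a _ => ?_
    by_cases ha : lam v a = 0
    · simp [ha]
    · rcases (hl1 v hv a ha).2 with h | h
      · obtain ⟨i, hi, rfl⟩ := Finset.mem_image.1 (Finset.mem_filter.1 h).1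
        rw [hc.base hi]
      · rw [hn a h]
  have hreach : ∀ v ∈ X1, ∀ w, Relation.ReflTransGen (arr G L1 q) v w → ρ w ≤ ρ v := by
    intro v hv w h
    induction h with
    | refl => exact le_rfl
    | tail h1 h2 ih => exact (hstep _ (hcfg.reach_mem hv h1) _ h2).trans ih
  intro v hv w h
  exact hρ2 v w (le_antisymm (hreach w (hcfg.reach_mem hv h.1) v h.2) (hreach v hv w h.1))

theorem exists_rho (D : V → V → Prop) : ∃ ρ : V → ℕ, (∀ v w, D v w → ρ w ≤ ρ v) ∧
    ∀ v w, ρ v = ρ w → scc D v w := by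
  classical
  let R : V → Finset V := fun v => Finset.univ.filter (Relation.ReflTransGen D v)
  let M := Fintype.card (Finset V)
  let e := Fintype.equivFin (Finset V)
  have hlt : ∀ S, (e S : ℕ) < M := fun S => (e S).2
  refine ⟨fun v => (R v).card * M + e (R v), fun v w h => ?_, fun v w h => ?_⟩
  · have hsub : R w ⊆ R v := by
      intro z hz
      simp only [R, Finset.mem_filter, Finset.mem_univ, true_and] at hz ⊢
      exact hz.head h
    by_cases he : R w = R v
    · simp [he]
    · have h1 := Finset.card_lt_card (Finset.ssubset_iff_subset_ne.2 ⟨hsub, he⟩)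
      have h2 := hlt (R w)
      have h3 : ((R w).card + 1) * M ≤ (R v).card * M := Nat.mul_le_mul_right _ h1
      simp only
      nlinarith
  · have h2 : (e (R v) : ℕ) = e (R w) := by
      have a1 : ((R v).card * M + e (R v)) % M = e (R v) := by
        rw [Nat.mul_add_mod_self_right]; exact Nat.mod_eq_of_lt (hlt _)
      have a2 : ((R w).card * M + e (R w)) % M = e (R w) := by
        rw [Nat.mul_add_mod_self_right]; exact Nat.mod_eq_of_lt (hlt _)
      rw [← a1, ← a2]; exact congrArg (· % M) h
    have h3 : R v = R w := e.injective (Fin.ext h2)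
    constructor
    · have : w ∈ R w := by simp [R, Relation.ReflTransGen.refl]
      rw [← h3] at this; simpa [R] using this
    · have : v ∈ R v := by simp [R, Relation.ReflTransGen.refl]
      rw [h3] at this; simpa [R] using this

theorem place (p : Fin N → V) (S : Finset (Fin N)) (B : Finset V) (hB : B.card + S.card ≤ N) :
    ∃ (q : Fin N → V) (nc : Finset (Fin N)), (∀ i ∈ S, q i = p i) ∧ Disjoint nc S ∧
      Set.InjOn q nc ∧ nc.image q = B := by
  classical
  obtain ⟨nc, hnc, hcard⟩ := Finset.exists_subset_card_eq (s := Sᶜ) (n := B.card) (by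
    rw [Finset.card_compl, Fintype.card_fin]; omega)
  let e : nc ≃ B := Finset.equivOfCardEq hcard
  refine ⟨fun i => if h : i ∈ nc then e ⟨i, h⟩ else p i, nc, ?_, ?_, ?_, ?_⟩
  · intro i hi
    have : i ∉ nc := fun h => (Finset.mem_compl.1 (hnc h)) hi
    simp [this]
  · exact Finset.disjoint_left.2 fun i h hi => (Finset.mem_compl.1 (hnc h)) hi
  · intro i hi j hj h
    have hi' : i ∈ nc := hi
    have hj' : j ∈ nc := hj
    simp only [hi', hj', dif_pos] at h
    have := e.injective (Subtype.ext h)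
    simpa using this
  · ext b
    simp only [Finset.mem_image]
    constructor
    · rintro ⟨i, hi, rfl⟩
      simp [hi]
    · intro hb
      refine ⟨e.symm ⟨b, hb⟩, (e.symm ⟨b, hb⟩).2, ?_⟩
      simp

theorem extend (hc : Cfg G X K p ia ib L) (hX : X = X1 ∪ X2) (hd : Disjoint X1 X2)
    (hK1 : cr G X1 ≤ K) (hK2 : cr G X2 ≤ K) (hN : 3 * K ≤ N) :
    ∃ (q : Fin N → V) (U ia1 ib1 ia2 ib2 : Finset (Fin N)) (L1 L2 : Fin N → Fin N → ZMod 2),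
      (∀ i ∈ ia ∪ ib, q i = p i) ∧ ia ∪ ib ⊆ U ∧
      Cfg G X1 K q ia1 ib1 L1 ∧ Cfg G X2 K q ia2 ib2 L2 ∧ ia1 ∪ ib1 ⊆ U ∧ ia2 ∪ ib2 ⊆ U ∧
      (∀ i ∈ U, q i ∈ X1 → i ∈ ia1) ∧ (∀ i ∈ U, q i ∈ X2 → i ∈ ia2) ∧
      (∀ v ∈ X1, ∀ w, scc (arr G L1 q) v w → scc (arr G L p) v w) ∧
      (∀ v ∈ X2, ∀ w, scc (arr G L2 q) v w → scc (arr G L p) v w) := by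
  classical
  obtain ⟨ρ, hρ1, hρ2⟩ := exists_rho (arr G L p)
  have h1 : X1 ⊆ X := hX ▸ Finset.subset_union_left
  have h2 : X2 ⊆ X := hX ▸ Finset.subset_union_right
  obtain ⟨A1, lam1, μ1, a1, a2, a3, a4, a5, a6, a7⟩ := side G X1 ρ _ (fun a ha => (Finset.mem_filter.1 ha).2) (hc.li h1)
  obtain ⟨A2, lam2, μ2, b1, b2, b3, b4, b5, b6, b7⟩ := side G X2 ρ _ (fun a ha => (Finset.mem_filter.1 ha).2) (hc.li h2)
  have hA : ia.image p ⊆ A1 ∪ A2 := by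
    intro a ha
    have : a ∈ X := by
      obtain ⟨i, hi, rfl⟩ := Finset.mem_image.1 ha
      exact hc.ma i hi
    rw [hX] at this
    rcases Finset.mem_union.1 this with h | h
    · exact Finset.mem_union_left _ (a1 (Finset.mem_filter.2 ⟨ha, h⟩))
    · exact Finset.mem_union_right _ (b1 (Finset.mem_filter.2 ⟨ha, h⟩))
  have hcia : (ia.image p).card = ia.card := Finset.card_image_of_injOn hc.inj
  obtain ⟨q, nc, q1, q2, q3, q4⟩ := place p (ia ∪ ib) ((A1 ∪ A2) \ ia.image p) (by
    rw [Finset.card_sdiff_of_subset hA, hcia]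
    have c1 := Finset.card_union_le A1 A2
    have c2 := Finset.card_union_le ia ib
    have c3 := hc.cb
    have c4 := Finset.card_le_card hA
    rw [hcia] at c4
    omega)
  have qia : ∀ i ∈ ia, q i = p i := fun i hi => q1 i (Finset.mem_union_left _ hi)
  have qib : ∀ i ∈ ib, q i = p i := fun i hi => q1 i (Finset.mem_union_right _ hi)
  have hncm : ∀ i ∈ nc, q i ∈ (A1 ∪ A2) \ ia.image p := fun i hi => q4 ▸ Finset.mem_image_of_mem q hi
  have hinj : Set.InjOn q (ia ∪ nc : Finset (Fin N)) := by
    intro i hi j hj h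
    rcases Finset.mem_union.1 (Finset.mem_coe.1 hi) with hi | hi <;>
    rcases Finset.mem_union.1 (Finset.mem_coe.1 hj) with hj | hj
    · exact hc.inj hi hj (by rw [← qia i hi, ← qia j hj, h])
    · exact absurd (h ▸ qia i hi ▸ Finset.mem_image_of_mem p hi) (Finset.mem_sdiff.1 (hncm j hj)).2
    · exact absurd (h ▸ qia j hj ▸ Finset.mem_image_of_mem p hj) (Finset.mem_sdiff.1 (hncm i hi)).2
    · exact q3 hi hj h
  have himg : (ia ∪ nc).image q = A1 ∪ A2 := by
    rw [Finset.image_union, q4, Finset.image_congr (fun i hi => qia i hi : Set.EqOn q p ia),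
      Finset.union_sdiff_of_subset hA]
  have hd' : ∀ a, a ∈ X1 → a ∈ X2 → False := fun a h h2 => Finset.disjoint_left.1 hd h h2
  let i1 := (ia ∪ nc).filter (q · ∈ X1)
  let i2 := (ia ∪ nc).filter (q · ∈ X2)
  have him1 : i1.image q = A1 := by
    ext a
    simp only [i1, Finset.mem_image, Finset.mem_filter]
    constructor
    · rintro ⟨i, ⟨hi, hx⟩, rfl⟩
      have := himg ▸ Finset.mem_image_of_mem q hi
      rcases Finset.mem_union.1 this with h | h
      · exact h
      · exact (hd' _ hx (b2 h)).elim
    · intro ha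
      have : a ∈ (ia ∪ nc).image q := himg ▸ Finset.mem_union_left _ ha
      obtain ⟨i, hi, rfl⟩ := Finset.mem_image.1 this
      exact ⟨i, ⟨hi, a2 ha⟩, rfl⟩
  have him2 : i2.image q = A2 := by
    ext a
    simp only [i2, Finset.mem_image, Finset.mem_filter]
    constructor
    · rintro ⟨i, ⟨hi, hx⟩, rfl⟩
      have := himg ▸ Finset.mem_image_of_mem q hi
      rcases Finset.mem_union.1 this with h | h
      · exact (hd' _ (a2 h) hx).elim
      · exact h
    · intro ha
      have : a ∈ (ia ∪ nc).image q := himg ▸ Finset.mem_union_right _ ha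
      obtain ⟨i, hi, rfl⟩ := Finset.mem_image.1 this
      exact ⟨i, ⟨hi, b2 ha⟩, rfl⟩
  have hin1 : Set.InjOn q i1 := hinj.mono (by intro i hi; exact Finset.mem_coe.2 (Finset.mem_filter.1 (Finset.mem_coe.1 hi)).1)
  have hin2 : Set.InjOn q i2 := hinj.mono (by intro i hi; exact Finset.mem_coe.2 (Finset.mem_filter.1 (Finset.mem_coe.1 hi)).1)
  have hout : ∀ w, w ∉ X → ∀ I : Finset (Fin N), Disjoint I ib → ∃ c : Fin N → ZMod 2, ∀ v ∈ X,
      ad G v w = ∑ j ∈ I ∪ ib, c j * ad G v (q j) := by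
    intro w hw I hI
    refine ⟨fun j => ∑ i, L j i * ad G (p i) w, fun v hv => ?_⟩
    rw [hc.expl v hv w hw, pred]
    rw [← Finset.sum_subset (Finset.subset_univ (I ∪ ib))]
    · refine Finset.sum_congr rfl fun j _ => ?_
      rw [Finset.sum_mul]
      refine Finset.sum_congr rfl fun i _ => ?_
      by_cases h : L j i = 0
      · simp [h]
      · rw [qib j (hc.supp j i h).1]; ring
    · intro j _ hj
      refine Finset.sum_eq_zero fun i _ => ?_
      have : L j i = 0 := by
        by_contra h
        exact hj (Finset.mem_union_right _ (hc.supp j i h).1)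
      simp [this]
  have hinn : ∀ (Y : Finset V) (A : Finset V) (I : Finset (Fin N)) (lam : V → ZMod 2) (w : V),
      Disjoint I ib → Set.InjOn q I → I.image q = A → (∀ a, lam a ≠ 0 → a ∈ A) →
      (∀ v ∈ Y, ad G w v = ∑ a, lam a * ad G a v) → 
      ∃ c : Fin N → ZMod 2, ∀ v ∈ Y, ad G v w = ∑ j ∈ I ∪ ib, c j * ad G v (q j) := by
    intro Y A I lam w hI hinj hAI hsupp hY
    refine ⟨fun j => if j ∈ I then lam (q j) else 0, fun v hv => ?_⟩
    rw [ad_comm, hY v hv, Finset.sum_union hI]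
    have : ∑ j ∈ ib, (if j ∈ I then lam (q j) else 0) * ad G v (q j) = 0 := by
      refine Finset.sum_eq_zero fun j hj => ?_
      have : j ∉ I := fun h => Finset.disjoint_left.1 hI h hj
      simp [this]
    rw [this, add_zero]
    have h3 : ∑ j ∈ I, (if j ∈ I then lam (q j) else 0) * ad G v (q j) = ∑ j ∈ I, lam (q j) * ad G (q j) v :=
      Finset.sum_congr rfl fun j hj => by rw [if_pos hj, ad_comm]
    rw [h3, ← Finset.sum_image (f := fun a => lam a * ad G a v) hinj, hAI]
    refine (Finset.sum_subset (Finset.subset_univ _) fun a _ ha => ?_).symm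
    rw [not_not.1 (mt (hsupp a) ha), zero_mul]
  have hibX : ∀ i ∈ ib, q i ∉ X := fun i hi => qib i hi ▸ hc.mb i hi
  have hI1 : Disjoint i1 ib := Finset.disjoint_left.2 fun i hi hib => hibX i hib (h1 (Finset.mem_filter.1 hi).2)
  have hI2 : Disjoint i2 ib := Finset.disjoint_left.2 fun i hi hib => hibX i hib (h2 (Finset.mem_filter.1 hi).2)
  obtain ⟨ib1, L1, hJ1, hC1, hr1⟩ := extend_side (ia1 := i1) (q := q) hc h1 hK1 ρ hρ1 hρ2 A1 lam1 μ1 a2 a3 a4 a5 a6 a7 hin1 him1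
    (i2 ∪ ib) (by
      intro j hj hx
      rcases Finset.mem_union.1 hj with h | h
      · exact hd' _ hx (Finset.mem_filter.1 h).2
      · exact hibX j h (h1 hx)) (by
      intro w hw
      by_cases hwX : w ∈ X
      · have hw2 : w ∈ X2 := by
          rw [hX] at hwX; exact (Finset.mem_union.1 hwX).resolve_left hw
        exact hinn X1 A2 i2 (lam2 w) w hI2 hin2 him2 (fun a ha => (b5 w hw2 a ha).1)
          (fun v hv => b6 w hw2 v fun h => hd' _ hv h)
      · obtain ⟨c, hc⟩ := hout w hwX i2 hI2
        exact ⟨c, fun v hv => hc v (h1 hv)⟩)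
  obtain ⟨ib2, L2, hJ2, hC2, hr2⟩ := extend_side (ia1 := i2) (q := q) hc h2 hK2 ρ hρ1 hρ2 A2 lam2 μ2 b2 b3 b4 b5 b6 b7 hin2 him2
    (i1 ∪ ib) (by
      intro j hj hx
      rcases Finset.mem_union.1 hj with h | h
      · exact hd' _ (Finset.mem_filter.1 h).2 hx
      · exact hibX j h (h2 hx)) (by
      intro w hw
      by_cases hwX : w ∈ X
      · have hw2 : w ∈ X1 := by
          rw [hX] at hwX; exact (Finset.mem_union.1 hwX).resolve_right hw
        exact hinn X2 A1 i1 (lam1 w) w hI1 hin1 him1 (fun a ha => (a5 w hw2 a ha).1)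
          (fun v hv => a6 w hw2 v fun h => hd' _ h hv)
      · obtain ⟨c, hc⟩ := hout w hwX i1 hI1
        exact ⟨c, fun v hv => hc v (h2 hv)⟩)
  have hs1 : i1 ⊆ ia ∪ nc := Finset.filter_subset _ _
  have hs2 : i2 ⊆ ia ∪ nc := Finset.filter_subset _ _
  have hU : ∀ i ∈ ia ∪ nc, i ∈ ia ∪ nc ∪ ib := fun i hi => Finset.mem_union_left _ hi
  have hUb : ∀ i ∈ ib, i ∈ ia ∪ nc ∪ ib := fun i hi => Finset.mem_union_right _ hi
  refine ⟨q, ia ∪ nc ∪ ib, i1, ib1, i2, ib2, L1, L2, q1, ?_, hC1, hC2, ?_, ?_, ?_, ?_, hr1, hr2⟩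
  · intro i hi
    rcases Finset.mem_union.1 hi with h | h
    · exact hU i (Finset.mem_union_left _ h)
    · exact hUb i h
  · intro i hi
    rcases Finset.mem_union.1 hi with h | h
    · exact hU i (hs1 h)
    · rcases Finset.mem_union.1 (hJ1 h) with h | h
      · exact hU i (hs2 h)
      · exact hUb i h
  · intro i hi
    rcases Finset.mem_union.1 hi with h | h
    · exact hU i (hs2 h)
    · rcases Finset.mem_union.1 (hJ2 h) with h | h
      · exact hU i (hs1 h)
      · exact hUb i h
  · intro i hi hx
    rcases Finset.mem_union.1 hi with h | h
    · exact Finset.mem_filter.2 ⟨h, hx⟩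
    · exact (hibX i h (h1 hx)).elim
  · intro i hi hx
    rcases Finset.mem_union.1 hi with h | h
    · exact Finset.mem_filter.2 ⟨h, hx⟩
    · exact (hibX i h (h2 hx)).elim

end Cfg

section Main
variable {V W : Type} [Fintype V] [DecidableEq V] [Fintype W] [DecidableEq W] {N : ℕ}
  {G : SimpleGraph V} {H : SimpleGraph W}

theorem C3_12 {r : ℕ} {p : Fin N → V} {p' : Fin N → W} {x y z : V} {x' y' z' : W}
    (h : C3 G r p x y z = C3 H r p' x' y' z') : C3 G r p z x y = C3 H r p' z' x' y' :=
  C3_swap12 (C3_swap23 h)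

theorem pieceJ {K r0 r : ℕ} {q : Fin N → V} {q' : Fin N → W} {D : V → V → Prop} {D' : W → W → Prop}
    {Y : Finset V} {iy jy U : Finset (Fin N)} {M : Fin N → Fin N → ZMod 2}
    (hD : CInv G H r0 q q' (Relation.ReflTransGen D) (Relation.ReflTransGen D')) (hr0 : r0 ≤ r)
    (ha : CInv G H r0 q q' (Relation.ReflTransGen (arr G M q)) (Relation.ReflTransGen (arr H M q')))
    (hY : Cfg G Y K q iy jy M) (hU : iy ∪ jy ⊆ U) (hUY : ∀ i ∈ U, q i ∈ Y → i ∈ iy)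
    (IH : ∀ y ∈ Y, ∀ y', C3 G r q y y y = C3 H r q' y' y' y' →
      PIso G H {z | scc (arr G M q) y z} {z | scc (arr H M q') y' z} (iy ∪ jy) q q')
    {x : V} {x' : W} (hx : C3 G (r + 7) q x x x = C3 H (r + 7) q' x' x' x')
    (hJY : ∀ y, scc D x y → y ∈ Y)
    (href : ∀ y z, scc D x y → scc (arr G M q) y z → scc D x z) :
    PIso G H {z | scc D x z} {z | scc D' x' z} U q q' := by
  have : Nonempty W := ⟨x'⟩
  obtain ⟨f, hf, _⟩ := C3_step (r := r + 6) hx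
  have hM : ∀ j i, M j i ≠ 0 → j ∈ U ∧ i ∈ U := fun j i h =>
    ⟨hU (Finset.mem_union_right _ (hY.supp j i h).1), hU (Finset.mem_union_left _ (hY.supp j i h).2)⟩
  have hJ : ∀ w, scc D x w ↔ scc D' x' (f w) := fun w =>
    (hD.mono (by omega : r0 ≤ r + 6)).scc_of _ _ _ _ _ _ (C3_swap23 (hf w))
  refine glue_lemma (r := r) (arr G M q) (arr H M q') (ha.mono hr0) {z | scc D x z} {z | scc D' x' z}
    (fun y hy z hz => href y z hy hz) ?_ f hJ
    (fun w _ => C3_diag (r := r + 4) (hf w)) M U hM ?_ (fun _ _ _ _ h => h) (fun _ _ _ _ h => h)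
  · intro y' hy' z' hz'
    obtain ⟨y, rfl⟩ := f.surjective y'
    obtain ⟨g, hg, _⟩ := C3_step (r := r + 5) (C3_swap23 (hf y))
    obtain ⟨z, rfl⟩ := g.surjective z'
    have h1 := (hD.mono (by omega : r0 ≤ r + 5)).scc_of _ _ _ _ _ _ (C3_swap23 (hg z))
    have h2 := (ha.mono (by omega : r0 ≤ r + 5)).scc_of _ _ _ _ _ _ (C3_swap12 (C3_12 (C3_swap12 (hg z))))
    exact h1.1 (href y z ((hJ y).2 hy') (h2.2 hz'))
  · intro y hy y' hy' hc
    have hyY := hJY y hy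
    obtain ⟨φ, h1, h2, h3⟩ := IH y hyY y' (C3_mono (by omega) hc)
    refine ⟨φ, h1, h2, fun u hu => ?_⟩
    have hu' : scc (arr H M q') y' (φ u) := h1.mapsTo hu
    obtain ⟨g, hg, _⟩ := C3_step hc
    obtain ⟨u2, hu2⟩ := g.surjective (φ u)
    have h4 := hg u2
    rw [hu2] at h4
    have h5 := ((ha.mono hr0).scc_of _ _ _ _ _ _ (C3_swap23 h4)).2 hu'
    have h6 := C3_UT U (C3_12 h4)
    have huY : u ∈ Y := hY.reach_mem hyY hu.1
    have hu2Y : u2 ∈ Y := hY.reach_mem hyY h5.1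
    have hty : ∀ i ∈ iy ∪ jy, (u = q i ↔ u2 = q i) ∧ (G.Adj u (q i) ↔ G.Adj u2 (q i)) := by
      intro i hi
      have e1 := h3 u hu i hi
      have e2 := h6 i (hU hi)
      exact ⟨e1.1.trans e2.1.symm, e1.2.trans e2.2.symm⟩
    have hty2 : ∀ i ∈ U, (u = q i ↔ u2 = q i) ∧ (G.Adj u (q i) ↔ G.Adj u2 (q i)) := by
      intro i hi
      by_cases hqi : q i ∈ Y
      · exact hty i (Finset.mem_union_left _ (hUY i hi hqi))
      · refine ⟨iff_of_false (fun h => hqi (h ▸ huY)) (fun h => hqi (h ▸ hu2Y)), ?_⟩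
        rw [← ad_eq_iff, hY.expl u huY _ hqi, hY.expl u2 hu2Y _ hqi]
        unfold pred
        refine Finset.sum_congr rfl fun j _ => Finset.sum_congr rfl fun l _ => ?_
        by_cases h : M j l = 0
        · simp [h]
        · rw [(ad_eq_iff G G _ _ _ _).2 (hty j (Finset.mem_union_right _ (hY.supp j l h).1)).2]
    intro i hi
    exact ⟨(hty2 i hi).1.trans (h6 i hi).1, (hty2 i hi).2.trans (h6 i hi).2⟩

variable (G) in
def Dec (K : ℕ) : ℕ → Finset V → Prop
  | 0, X => cr G X ≤ K ∧ X.card ≤ 1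
  | (h + 1), X => cr G X ≤ K ∧ ∃ X1 X2, X = X1 ∪ X2 ∧ Disjoint X1 X2 ∧ Dec K h X1 ∧ Dec K h X2

theorem Dec.cr {K h : ℕ} {X : Finset V} (hd : Dec G K h X) : cr G X ≤ K := by
  cases h with
  | zero => exact hd.1
  | succ h => exact hd.1

theorem arr_congr {L : Fin N → Fin N → ZMod 2} {p q : Fin N → V} (S : Finset (Fin N))
    (hL : ∀ j i, L j i ≠ 0 → j ∈ S ∧ i ∈ S) (h : ∀ i ∈ S, q i = p i) : arr G L q = arr G L p := by
  funext v w
  unfold arr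
  congr 1
  unfold pred
  refine Finset.sum_congr rfl fun j _ => Finset.sum_congr rfl fun i _ => ?_
  by_cases hz : L j i = 0
  · simp [hz]
  · rw [h j (hL j i hz).1, h i (hL j i hz).2]

theorem Cfg.congr {X : Finset V} {K : ℕ} {p q : Fin N → V} {ia ib : Finset (Fin N)}
    {L : Fin N → Fin N → ZMod 2} (hc : Cfg G X K p ia ib L) (h : ∀ i ∈ ia ∪ ib, q i = p i) :
    arr G L q = arr G L p ∧ ∀ (p' q' : Fin N → W), (∀ i ∈ ia ∪ ib, q' i = p' i) →
      arr H L q' = arr H L p' := by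
  have hL : ∀ j i, L j i ≠ 0 → j ∈ ia ∪ ib ∧ i ∈ ia ∪ ib := fun j i hz =>
    ⟨Finset.mem_union_right _ (hc.supp j i hz).1, Finset.mem_union_left _ (hc.supp j i hz).2⟩
  exact ⟨arr_congr _ hL h, fun p' q' h' => arr_congr _ hL h'⟩

theorem mainP {K s : ℕ} (hV : Fintype.card V ≤ 2 ^ s) (hW : Fintype.card W ≤ 2 ^ s) (hN : 3 * K ≤ N)
    (h : ℕ) : ∀ X, Dec G K h X → ∀ (p : Fin N → V) (p' : Fin N → W) ia ib L, Cfg G X K p ia ib L →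
    ∀ v ∈ X, ∀ v', C3 G (2 * s + 1 + h * (13 + N)) p v v v = C3 H (2 * s + 1 + h * (13 + N)) p' v' v' v' →
    PIso G H {y | scc (arr G L p) v y} {y | scc (arr H L p') v' y} (ia ∪ ib) p p' := by
  induction h with
  | zero =>
    intro X hX p p' ia ib L hc v hv v' hvv
    have hXv : ∀ y ∈ X, y = v := fun y hy => Finset.card_le_one.1 hX.2 y hy v hv
    have e1 : {y | scc (arr G L p) v y} = {v} := by
      ext y
      exact ⟨fun hy => hXv y (hc.reach_mem hv hy.1), fun hy => by
        have : y = v := hy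
        subst this; exact scc_refl _ _⟩
    have e2 : {y | scc (arr H L p') v' y} = {v'} := by
      ext y'
      refine ⟨fun hy => ?_, fun hy => by
        have : y' = v' := hy
        subst this; exact scc_refl _ _⟩
      have hvv1 : C3 G (2 * s + 1) p v v v = C3 H (2 * s + 1) p' v' v' v' := C3_mono (by omega) hvv
      obtain ⟨f, hf, _⟩ := C3_step hvv1
      obtain ⟨y, rfl⟩ := f.surjective y'
      have h1 := (((CInv_arr 0 L).reach s hV hW).mono (by omega : 0 + s ≤ 2 * s)).scc_of _ _ _ _ _ _ (C3_swap23 (hf y))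
      have h2 := hXv y (hc.reach_mem hv (h1.2 hy).1)
      exact ((C3_eq23 (hf y)).1 h2.symm).symm
    rw [e1, e2]
    refine ⟨fun _ => v', ⟨by simp [Set.MapsTo], by simp, by simp [Set.SurjOn]⟩, ?_, ?_⟩
    · rintro x rfl y rfl; simp
    · rintro x rfl; exact C3_UT _ hvv
  | succ h ih =>
    intro X hX p p' ia ib L hc v hv v' hvv
    have : Nonempty W := ⟨v'⟩
    obtain ⟨_, X1, X2, hX12, hdis, hX1, hX2⟩ := hX
    obtain ⟨q, U, ia1, ib1, ia2, ib2, L1, L2, hqp, hU, hC1, hC2, hU1, hU2, hm1, hm2, hr1, hr2⟩ :=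
      extend hc hX12 hdis hX1.cr hX2.cr hN
    set R := 2 * s + 1 + h * (13 + N) with hR
    have hS : (ia ∪ ib)ᶜ.card ≤ N := by
      simpa using Finset.card_le_univ ((ia ∪ ib)ᶜ : Finset (Fin N))
    have hvv2 : C3 G (R + 13 + (ia ∪ ib)ᶜ.card) p v v v = C3 H (R + 13 + (ia ∪ ib)ᶜ.card) p' v' v' v' :=
      C3_mono (by
        have e : (h + 1) * (13 + N) = h * (13 + N) + (13 + N) := Nat.succ_mul _ _
        omega) hvv
    obtain ⟨q', hq', hvq⟩ := C3_repebble (ia ∪ ib)ᶜ q (fun i hi => hqp i (not_not.1 fun h => hi (Finset.mem_compl.2 h))) hvv2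
    have hq'p : ∀ i ∈ ia ∪ ib, q' i = p' i := fun i hi => hq' i (fun h => (Finset.mem_compl.1 h) hi)
    obtain ⟨ha0, ha0'⟩ := hc.congr (W := W) (H := H) hqp
    have ha0' := ha0' p' q' hq'p
    suffices hmain : PIso G H {y | scc (arr G L q) v y} {y | scc (arr H L q') v' y} U q q' by
      rw [ha0, ha0'] at hmain
      obtain ⟨φ, h1, h2, h3⟩ := hmain
      refine ⟨φ, h1, h2, fun x hx i hi => ?_⟩
      have := h3 x hx i (hU hi)
      rwa [hqp i hi, hq'p i hi] at this
    rw [← ha0] at hr1 hr2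
    have hXm : ∀ x y, x ∈ X → scc (arr G L q) x y → y ∈ X := by
      intro x y hx hy
      rw [ha0] at hy
      exact hc.reach_mem hx hy.1
    have inv0 : CInv G H s q q' (scc (arr G L q)) (scc (arr H L q')) := by
      have := ((CInv_arr (G := G) (H := H) (p := q) (p' := q') 0 L).reach s hV hW).scc_of
      rwa [Nat.zero_add] at this
    have inv1 : ∀ M, CInv G H (2 * s) q q' (Relation.ReflTransGen (arr G M q)) (Relation.ReflTransGen (arr H M q')) :=
      fun M => ((CInv_arr 0 M).reach s hV hW).mono (by omega)
    let D : V → V → Prop := fun x y => scc (arr G L q) x y ∧ (arr G L1 q x y ∨ arr G L2 q y x)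
    let D' : W → W → Prop := fun x y => scc (arr H L q') x y ∧ (arr H L1 q' x y ∨ arr H L2 q' y x)
    have invD : CInv G H (2 * s) q q' (Relation.ReflTransGen D) (Relation.ReflTransGen D') := by
      have : CInv G H s q q' D D' := fun x y z x' y' z' hc =>
        and_congr (inv0 _ _ _ _ _ _ hc) (or_congr (CInv_arr _ _ _ _ _ _ _ _ hc) (CInv_arr _ _ _ _ _ _ _ _ (C3_swap12 hc)))
      have := this.reach s hV hW
      rwa [← two_mul] at this
    have hDE : ∀ x y, Relation.ReflTransGen D x y → scc (arr G L q) x y := by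
      intro x y hxy
      induction hxy with
      | refl => exact scc_refl _ _
      | tail _ h2 ih => exact scc_trans ih h2.1
    have hDE' : ∀ x y, Relation.ReflTransGen D' x y → scc (arr H L q') x y := by
      intro x y hxy
      induction hxy with
      | refl => exact scc_refl _ _
      | tail _ h2 ih => exact scc_trans ih h2.1
    have hX1X : ∀ x ∈ X1, x ∈ X := fun x hx => hX12 ▸ Finset.mem_union_left _ hx
    have hX2X : ∀ x ∈ X2, x ∈ X := fun x hx => hX12 ▸ Finset.mem_union_right _ hx
    have hor : ∀ x ∈ X, x ∈ X1 ∨ x ∈ X2 := fun x hx => Finset.mem_union.1 (hX12 ▸ hx)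
    have hcl : ∀ x y, x ∈ X1 → Relation.ReflTransGen D x y → y ∈ X1 := by
      intro x y hx hxy
      induction hxy with
      | refl => exact hx
      | tail _ h2 ih =>
        rcases h2.2 with h3 | h3
        · exact hC1.arr_mem ih h3
        · rcases hor _ (hXm _ _ (hX1X _ ih) h2.1) with h4 | h4
          · exact h4
          · exact (Finset.disjoint_left.1 hdis ih (hC2.arr_mem h4 h3)).elim
    have hsub : ∀ (M : Fin N → Fin N → ZMod 2) (S : Finset (Fin N)) (T : Finset (Fin N)), (∀ j i, M j i ≠ 0 → j ∈ S ∧ i ∈ T) →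
        T ∪ S ⊆ U → ∀ j i, (M j i : ZMod 2) ≠ 0 → j ∈ U ∧ i ∈ U := fun M S T h1 h2 j i hji =>
      ⟨h2 (Finset.mem_union_right _ (h1 j i hji).1), h2 (Finset.mem_union_left _ (h1 j i hji).2)⟩
    obtain ⟨f, hf, _⟩ := C3_step (r := R + 12) hvq
    refine glue_lemma (r := R + 6) D D' (invD.mono (by omega)) _ _
      (fun x hx y hy => scc_trans hx (hDE _ _ hy.1)) (fun x hx y hy => scc_trans hx (hDE' _ _ hy.1)) f
      (fun x => (inv0.mono (by omega : s ≤ R + 12)) _ _ _ _ _ _ (C3_swap23 (hf x)))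
      (fun x _ => C3_diag (r := R + 10) (hf x)) L1 U (hsub L1 ib1 ia1 hC1.supp hU1) ?_
      (fun x hx y hy hxy => ⟨scc_trans (scc_symm hx) hy, Or.inl hxy⟩)
      (fun x hx y hy hxy => ⟨scc_trans (scc_symm hx) hy, Or.inl hxy⟩)
    intro x hx x' hx' hxx
    have hxX : x ∈ X := hXm _ _ hv hx
    rcases hor x hxX with hx1 | hx2
    · refine pieceJ (r0 := 2 * s) (r := R) invD (by omega) (inv1 L1) hC1 hU1 hm1
        (fun y hy y' hyy => ih X1 hX1 q q' ia1 ib1 L1 hC1 y hy y' hyy) hxx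
        (fun y hy => hcl _ _ hx1 hy.1) (fun y z hy hz => scc_trans hy ?_)
      have hyX1 := hcl _ _ hx1 hy.1
      have key : ∀ y ∈ X1, ∀ z, scc (arr G L1 q) y z → Relation.ReflTransGen D y z := by
        intro y hy z hz
        obtain ⟨hz1, hz2⟩ := hz
        induction hz1 with
        | refl => exact .refl
        | @tail b c h1 h2 ih2 =>
          have hb := hC1.reach_mem hy h1
          refine (ih2 (.head h2 hz2)).tail ⟨hr1 b hb c ⟨.single h2, hz2.trans h1⟩, Or.inl h2⟩
      exact ⟨key y hyX1 z hz, key z (hC1.reach_mem hyX1 hz.1) y (scc_symm hz)⟩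
    · have hJ2 : ∀ y, scc D x y → y ∈ X2 := by
        intro y hy
        rcases hor y (hXm _ _ hxX (hDE _ _ hy.1)) with h4 | h4
        · exact (Finset.disjoint_left.1 hdis (hcl _ _ h4 hy.2) hx2).elim
        · exact h4
      refine pieceJ (r0 := 2 * s) (r := R) invD (by omega) (inv1 L2) hC2 hU2 hm2
        (fun y hy y' hyy => ih X2 hX2 q q' ia2 ib2 L2 hC2 y hy y' hyy) hxx
        hJ2 (fun y z hy hz => scc_trans hy ?_)
      have hyX2 := hJ2 y hy
      have key : ∀ y ∈ X2, ∀ z, scc (arr G L2 q) y z → Relation.ReflTransGen D z y := by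
        intro y hy z hz
        obtain ⟨hz1, hz2⟩ := hz
        induction hz1 with
        | refl => exact .refl
        | @tail b c h1 h2 ih2 =>
          have hb := hC2.reach_mem hy h1
          refine Relation.ReflTransGen.head ⟨scc_symm (hr2 b hb c ⟨.single h2, hz2.trans h1⟩), Or.inr h2⟩ (ih2 (.head h2 hz2))
      exact ⟨key z (hC2.reach_mem hyX2 hz.1) y (scc_symm hz), key y hyX2 z hz⟩

end Main

section Bal
variable {V : Type} [Fintype V] [DecidableEq V] {G : SimpleGraph V}

theorem rank_add_le' (A B : Matrix V V (ZMod 2)) : (A + B).rank ≤ A.rank + B.rank := by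
  unfold Matrix.rank
  rw [Matrix.mulVecLin_add]
  refine (Submodule.finrank_mono (LinearMap.range_add_le _ _)).trans ?_
  exact Submodule.finrank_add_le_finrank_add_finrank _ _

theorem cr_le (X : Finset V) : cr G X ≤ cutRank G X := by
  classical
  unfold cr cutRank
  set M := (Matrix.of fun (u : ↥X) (w : ↥(Xᶜ)) => if G.Adj ↑u ↑w then (1 : ZMod 2) else 0) with hM
  have : MX G X = (Matrix.of fun (v : V) (u : ↥X) => if v = u then (1 : ZMod 2) else 0) * M *
      (Matrix.of fun (w : ↥(Xᶜ)) (v : V) => if v = w then (1 : ZMod 2) else 0) := by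
    ext v w
    simp only [MX, Matrix.mul_apply, Matrix.of_apply]
    by_cases hv : v ∈ X
    · by_cases hw : w ∈ X
      · rw [if_neg (by tauto)]
        refine (Finset.sum_eq_zero fun j _ => ?_).symm
        rw [if_neg, mul_zero]
        rintro rfl
        exact (Finset.mem_compl.1 j.2) hw
      · rw [if_pos ⟨hv, hw⟩, Finset.sum_eq_single ⟨w, Finset.mem_compl.2 hw⟩, Finset.sum_eq_single ⟨v, hv⟩]
        · simp [hM, ad]
        · intro b _ hb
          rw [if_neg, zero_mul]
          rintro rfl; exact hb rfl
        · simp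
        · intro b _ hb
          rw [if_neg, mul_zero]
          rintro rfl; exact hb rfl
        · simp
    · rw [if_neg (by tauto)]
      refine (Finset.sum_eq_zero fun j _ => ?_).symm
      rw [Finset.sum_eq_zero, zero_mul]
      intro x _
      rw [if_neg, zero_mul]
      rintro rfl
      exact hv x.2
  rw [this]
  exact (Matrix.rank_mul_le_left _ _).trans (Matrix.rank_mul_le_right _ _)

theorem cr_sdiff (S T : Finset V) (h : T ⊆ S) : cr G (S \ T) ≤ cr G S + cr G T := by
  have : MX G (S \ T) = Matrix.diagonal (fun v => if v ∈ S \ T then (1 : ZMod 2) else 0) * MX G S +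
      Matrix.diagonal (fun v => if v ∈ S \ T then (1 : ZMod 2) else 0) * (MX G T).transpose := by
    ext v w
    simp only [Matrix.add_apply, Matrix.diagonal_mul, MX, Matrix.transpose_apply, Matrix.of_apply,
      Finset.mem_sdiff, ad_comm G w v]
    have := @h w
    have := @h v
    by_cases h1 : v ∈ S <;> by_cases h2 : v ∈ T <;> by_cases h3 : w ∈ S <;> by_cases h4 : w ∈ T <;>
      simp_all
  unfold cr
  rw [this]
  refine (rank_add_le' _ _).trans ?_
  refine (add_le_add (Matrix.rank_mul_le_right _ _) (Matrix.rank_mul_le_right _ _)).trans ?_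
  rw [Matrix.rank_transpose]

theorem cr_empty : cr G ∅ = 0 := by
  have : MX G ∅ = 0 := by
    ext v w
    simp [MX]
  unfold cr
  rw [this, Matrix.rank_zero]

theorem Dec.empty (K h : ℕ) : Dec G K h ∅ := by
  induction h with
  | zero => exact ⟨by rw [cr_empty]; omega, by simp⟩
  | succ h ih => exact ⟨by rw [cr_empty]; omega, ∅, ∅, by simp, by simp, ih, ih⟩

theorem Dec.succ {K h : ℕ} {X : Finset V} (hd : Dec G K h X) : Dec G K (h + 1) X :=
  ⟨hd.cr, X, ∅, by simp, by simp, hd, Dec.empty K h⟩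

theorem Dec.mono {K h h' : ℕ} (hh : h ≤ h') {X : Finset V} (hd : Dec G K h X) : Dec G K h' X := by
  induction hh with
  | refl => exact hd
  | step _ ih => exact ih.succ
end Bal

section Bal2
variable {V : Type} [Fintype V] [DecidableEq V] {G : SimpleGraph V}

def fs : RWTree V → Finset V
  | .leaf v => {v}
  | .node l r => fs l ∪ fs r

theorem fs_leaves (T : RWTree V) : T.leaves.toFinset = fs T := by
  induction T with
  | leaf v => simp [RWTree.leaves, fs]
  | node l r ihl ihr => simp [RWTree.leaves, fs, ihl, ihr]

variable (G) in
def Good (k : ℕ) : RWTree V → Prop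
  | .leaf v => cr G {v} ≤ k
  | .node l r => cr G (fs l ∪ fs r) ≤ k ∧ Disjoint (fs l) (fs r) ∧ Good k l ∧ Good k r

def STr (P : RWTree V) : RWTree V → Prop
  | .leaf v => P = .leaf v
  | .node l r => P = .node l r ∨ STr P l ∨ STr P r

theorem STr.refl (P : RWTree V) : STr P P := by
  cases P with
  | leaf v => rfl
  | node l r => exact Or.inl rfl

theorem STr.trans {P Q T : RWTree V} (h1 : STr P Q) (h2 : STr Q T) : STr P T := by
  induction T with
  | leaf v => cases h2; exact h1
  | node l r ihl ihr =>
    rcases h2 with rfl | h2 | h2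
    · exact h1
    · exact Or.inr (Or.inl (ihl h2))
    · exact Or.inr (Or.inr (ihr h2))

theorem STr.subset {P T : RWTree V} (h : STr P T) : fs P ⊆ fs T := by
  induction T with
  | leaf v => cases h; exact subset_rfl
  | node l r ihl ihr =>
    rcases h with rfl | h | h
    · exact subset_rfl
    · exact (ihl h).trans Finset.subset_union_left
    · exact (ihr h).trans Finset.subset_union_right

theorem STr.good {k : ℕ} {P T : RWTree V} (h : STr P T) (hT : Good G k T) : Good G k P := by
  induction T with
  | leaf v => cases h; exact hT
  | node l r ihl ihr =>
    rcases h with rfl | h | h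
    · exact hT
    · exact ihl h hT.2.2.1
    · exact ihr h hT.2.2.2

theorem Good.cr {k : ℕ} {T : RWTree V} (hT : Good G k T) : cr G (fs T) ≤ k := by
  cases T with
  | leaf v => exact hT
  | node l r => exact hT.1

theorem good_of {k : ℕ} (T : RWTree V) (hn : T.leaves.Nodup)
    (h : ∀ s ∈ T.subtrees, cutRank G s.leaves.toFinset ≤ k) : Good G k T := by
  induction T with
  | leaf v =>
    have := h (.leaf v) (by simp [RWTree.subtrees])
    rw [fs_leaves] at this
    exact (cr_le _).trans this
  | node l r ihl ihr =>
    have h0 := h (.node l r) (by simp [RWTree.subtrees])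
    rw [fs_leaves] at h0
    have hn' := Multiset.nodup_add.1 hn
    refine ⟨(cr_le _).trans h0, ?_, ihl hn'.1 fun s hs => h s (by simp [RWTree.subtrees, hs]),
      ihr hn'.2.1 fun s hs => h s (by simp [RWTree.subtrees, hs])⟩
    rw [← fs_leaves, ← fs_leaves, Finset.disjoint_left]
    intro a ha hb
    exact Multiset.disjoint_left.1 hn'.2.2 (Multiset.mem_toFinset.1 ha) (Multiset.mem_toFinset.1 hb)

theorem findP {m : ℕ} (hm : 1 ≤ m) (T : RWTree V) (h : m < (fs T).card) :
    ∃ l r, STr (.node l r) T ∧ m < (fs (.node l r)).card ∧ (fs l).card ≤ m ∧ (fs r).card ≤ m := by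
  induction T with
  | leaf v => simp [fs] at h; omega
  | node l r ihl ihr =>
    by_cases h1 : m < (fs l).card
    · obtain ⟨a, b, h2, h3⟩ := ihl h1
      exact ⟨a, b, Or.inr (Or.inl h2), h3⟩
    by_cases h2 : m < (fs r).card
    · obtain ⟨a, b, h2, h3⟩ := ihr h2
      exact ⟨a, b, Or.inr (Or.inr h2), h3⟩
    exact ⟨l, r, STr.refl _, h, by omega, by omega⟩

theorem walk {m k : ℕ} (T P Q : RWTree V) (hT : Good G k T) (hQT : STr Q T) (hPQ : STr P Q)
    (h1 : (fs T \ fs Q).card ≤ m) (h2 : m < (fs T \ fs P).card) :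
    ∃ Q c d, STr Q T ∧ STr P c ∧ STr c Q ∧ STr d Q ∧ fs Q = fs c ∪ fs d ∧ Disjoint (fs c) (fs d) ∧
      (fs T \ fs Q).card ≤ m ∧ m < (fs T \ fs c).card := by
  induction Q with
  | leaf v => cases hPQ; omega
  | node l r ihl ihr =>
    have hl : STr l (.node l r) := Or.inr (Or.inl (STr.refl _))
    have hr : STr r (.node l r) := Or.inr (Or.inr (STr.refl _))
    have hg := (hQT.good hT)
    rcases hPQ with rfl | h | h
    · omega
    · by_cases hc : (fs T \ fs l).card ≤ m
      · exact ihl (hl.trans hQT) h hc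
      · exact ⟨_, l, r, hQT, h, hl, hr, rfl, hg.2.1, h1, by omega⟩
    · by_cases hc : (fs T \ fs r).card ≤ m
      · exact ihr (hr.trans hQT) h hc
      · exact ⟨_, r, l, hQT, h, hr, hl, Finset.union_comm _ _, hg.2.1.symm, h1, by omega⟩

theorem card_sdiff_add (S T : Finset V) (h : T ⊆ S) : (S \ T).card + T.card = S.card :=
  Finset.card_sdiff_add_card_eq_card h

theorem bal {k : ℕ} (j : ℕ) : (∀ T, Good G k T → (fs T).card ≤ 2 ^ j → Dec G (2 * k) (4 * j) (fs T)) ∧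
    (∀ T P, Good G k T → STr P T → (fs T \ fs P).card ≤ 2 ^ j → Dec G (2 * k) (4 * j) (fs T \ fs P)) := by
  have hcr : ∀ T P, Good G k T → STr P T → cr G (fs T \ fs P) ≤ 2 * k := by
    intro T P hT hP
    have := cr_sdiff (G := G) (fs T) (fs P) hP.subset
    have := hT.cr
    have := (hP.good hT).cr
    omega
  induction j with
  | zero =>
    refine ⟨fun T hT h => ⟨?_, by simpa using h⟩, fun T P hT hP h => ⟨hcr T P hT hP, by simpa using h⟩⟩
    have := hT.cr
    omega
  | succ j ih =>
    obtain ⟨ihA, ihB⟩ := ih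
    have hp : 2 ^ (j + 1) = 2 ^ j + 2 ^ j := by rw [pow_succ]; omega
    have hp1 : 1 ≤ 2 ^ j := Nat.one_le_two_pow
    have A : ∀ T, Good G k T → (fs T).card ≤ 2 ^ (j + 1) → Dec G (2 * k) (4 * j + 2) (fs T) := by
      intro T hT h
      by_cases hs : (fs T).card ≤ 2 ^ j
      · exact (ihA T hT hs).mono (by omega)
      obtain ⟨l, r, h1, h2, h3, h4⟩ := findP hp1 T (by omega)
      have hg := h1.good hT
      have hcT := hT.cr
      have hcg := hg.cr
      have hs := card_sdiff_add _ _ h1.subset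
      refine ⟨by omega, fs T \ fs (.node l r), fs (.node l r), (Finset.sdiff_union_of_subset h1.subset).symm,
        Finset.sdiff_disjoint, (ihB _ _ hT h1 (by omega)).succ, ⟨by omega, fs l, fs r, rfl, hg.2.1,
          ihA l hg.2.2.1 h3, ihA r hg.2.2.2 h4⟩⟩
    refine ⟨fun T hT h => (A T hT h).mono (by omega), fun T P hT hP h => ?_⟩
    by_cases hs : (fs T \ fs P).card ≤ 2 ^ j
    · exact (ihB T P hT hP hs).mono (by omega)
    obtain ⟨Q, c, d, hQT, hPc, hcQ, hdQ, hQ, hdj, h1, h2⟩ := walk T P T hT (STr.refl _) hP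
      (m := 2 ^ j) (by simp) (by omega)
    have hPQ := hPc.trans hcQ
    have e1 := card_sdiff_add _ _ hP.subset
    have e2 := card_sdiff_add _ _ (hcQ.trans hQT).subset
    have e3 := card_sdiff_add _ _ hPc.subset
    have hdP : fs d ⊆ fs T \ fs P := by
      intro x hx
      exact Finset.mem_sdiff.2 ⟨hQT.subset (hdQ.subset hx), fun hxP =>
        Finset.disjoint_left.1 hdj (hPc.subset hxP) hx⟩
    have e4 := Finset.card_le_card hdP
    show Dec G (2 * k) (4 * j + 2 + 1 + 1) (fs T \ fs P)
    refine ⟨hcr T P hT hP, fs T \ fs Q, fs Q \ fs P, ?_, ?_, (ihB T Q hT hQT h1).mono (by omega), ?_⟩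
    · have a1 := hQT.subset
      have a2 := hPQ.subset
      ext x
      have := @a1 x
      have := @a2 x
      simp only [Finset.mem_union, Finset.mem_sdiff]
      tauto
    · rw [Finset.disjoint_left]
      intro x hx hy
      exact (Finset.mem_sdiff.1 hx).2 (Finset.mem_sdiff.1 hy).1
    · refine ⟨hcr Q P (hQT.good hT) hPQ, fs d, fs c \ fs P, ?_, ?_, A d (hdQ.good (hQT.good hT)) (by omega),
        (ihB c P (hcQ.good (hQT.good hT)) hPc (by omega)).mono (by omega)⟩
      · ext x
        have a1 := Finset.disjoint_left.1 hdj
        have := @a1 x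
        have a2 := hPc.subset
        have := @a2 x
        simp only [Finset.mem_union, Finset.mem_sdiff, hQ]
        tauto
      · exact (hdj.mono_left Finset.sdiff_subset).symm

theorem dec_univ {k : ℕ} (h : RankwidthLE G k) (j : ℕ) (hj : Fintype.card V ≤ 2 ^ j) :
    Dec G (2 * k) (4 * j) Finset.univ := by
  obtain ⟨T, h1, h2⟩ := h
  have h3 := good_of T (h1 ▸ Finset.univ.nodup) h2
  have h4 : fs T = Finset.univ := by
    rw [← fs_leaves, h1]; simp
  rw [← h4]
  exact (bal j).1 T h3 (by rw [h4]; simpa using hj)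
end Bal2

/-- For every `k ≥ 1` there is a constant `c` (depending only on `k`) such
that for every graph `G` of rank width at most `k` on `n` vertices and every graph `H` not
isomorphic to `G`, running `(6k+3)`-dimensional WL for at most `c · (log₂ n + 1)` rounds
distinguishes `G` from `H`. -/
theorem wl_identifies_bounded_rankwidth_in_log_rounds (k : ℕ) (hk : 1 ≤ k) :
    ∃ c : ℕ, ∀ (V W : Type) [Fintype V] [DecidableEq V] [Fintype W] [DecidableEq W]
      (G : SimpleGraph V) (H : SimpleGraph W),
      RankwidthLE G k → ¬ Nonempty (G ≃g H) →
      wlMultiset G (fun _ => ()) (6 * k + 3) (c * (Nat.log 2 (Fintype.card V) + 1)) ≠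
        wlMultiset H (fun _ => ()) (6 * k + 3) (c * (Nat.log 2 (Fintype.card V) + 1)) := by
  refine ⟨62 + 24 * k, ?_⟩
  intro V W _ _ _ _ G H hG hne heq
  apply hne
  obtain ⟨e, he⟩ := exists_equiv_of_map_univ_eq _ _ heq
  rcases isEmpty_or_nonempty V with hV | ⟨⟨v0⟩⟩
  · have : IsEmpty W := ⟨fun w => (hV.false (e.symm (fun _ => w) 0))⟩
    exact ⟨⟨Equiv.equivOfIsEmpty V W, fun {a} => hV.elim a⟩⟩
  set s := Nat.log 2 (Fintype.card V) + 1 with hs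
  have hn : Fintype.card V ≤ 2 ^ s := (Nat.lt_pow_succ_log_self (by norm_num) _).le
  have hd := dec_univ hG s hn
  let p : Fin (6 * k) → V := fun _ => v0
  obtain ⟨p', x', y', z', hu⟩ : ∃ (p' : Fin (6 * k) → W) (x' y' z' : W),
      e (tup3 p v0 v0 v0) = tup3 p' x' y' z' := by
    refine ⟨fun i => e (tup3 p v0 v0 v0) (Fin.castAdd 3 i), e (tup3 p v0 v0 v0) (Fin.natAdd _ 0),
      e (tup3 p v0 v0 v0) (Fin.natAdd _ 1), e (tup3 p v0 v0 v0) (Fin.natAdd _ 2), ?_⟩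
    funext i
    refine Fin.addCases (fun i => ?_) (fun i => ?_) i
    · simp [tup3]
    · unfold tup3
      rw [Fin.append_right]
      fin_cases i <;> rfl
  have h0 := he (tup3 p v0 v0 v0)
  rw [hu] at h0
  set R := 2 * s + 1 + (4 * s) * (13 + 6 * k) with hR
  have hb : R + 7 ≤ (62 + 24 * k) * s := by
    have : 1 ≤ s := by omega
    nlinarith
  have h1 : C3 G (R + 7) p v0 v0 v0 = C3 H (R + 7) p' x' y' z' := C3_mono hb h0
  obtain ⟨f, hf, _⟩ := C3_step (r := R + 6) h1
  have hW : Fintype.card W ≤ 2 ^ s := by rw [← Fintype.card_congr f]; exact hn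
  have : Nonempty W := ⟨x'⟩
  have hcfg : Cfg G Finset.univ (2 * k) p ∅ ∅ 0 :=
    ⟨by simp, by simp, by simp, by simp, by simp, by simp, by simp⟩
  have hP : PIso G H Set.univ Set.univ ∅ p p' := by
    refine glue_lemma (r := R) (arr G 0 p) (arr H 0 p') (((CInv_arr 0 0).reach s hn hW).mono (by omega))
      Set.univ Set.univ (by simp) (by simp) f (by simp) (fun x _ => C3_diag (r := R + 4) (hf x)) 0 ∅
      (by simp) ?_ (fun _ _ _ _ h => h) (fun _ _ _ _ h => h)
    intro x _ x' _ hx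
    exact mainP hn hW (by omega) (4 * s) Finset.univ hd p p' ∅ ∅ 0 hcfg x (Finset.mem_univ _) x'
      (C3_mono (by omega) hx)
  obtain ⟨φ, hb1, hb2, _⟩ := hP
  refine ⟨⟨Equiv.ofBijective φ (Set.bijOn_univ.1 hb1), ?_⟩⟩
  intro a b
  exact (hb2 a trivial b trivial).symm
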